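/- Let n ≥ 5, let G = Sₙ be the symmetric group on n letters, and let H be a nontrivial nilpotent subgroup of G; if n = 8, assume additionally that H is not a Sylow 2-subgroup of G. Then any two irreducible complex characters of H are linked over G; that is, the Külshammer graph K(G,H) is complete, and consequently d_G(H) = 3. -/

import Mathlib

noncomputable section

/-- The usual inner product of class functions on a finite group `H`. -/
def charInner (H : Type) (φ ψ : H → ℂ) : ℂ :=
  (Nat.card H : ℂ)⁻¹ * ∑ᶠ h : H, φ h * (starRingEnd ℂ) (ψ h)

/-- `χ : H → ℂ` is the character of an irreducible complex representation of `H`. -/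
def IsIrrChar (H : Type) [Group H] (χ : H → ℂ) : Prop :=
  ∃ V : FDRep ℂ H, CategoryTheory.Simple V ∧ χ = V.character

/-- Restriction of a class function on `G` to a subgroup `H`. -/
def resChar {G : Type} [Group G] (H : Subgroup G) (χ : G → ℂ) : ↥H → ℂ :=
  fun h => χ (h : G)

/-- Two irreducible characters `α, β` of a subgroup `H ≤ G` are linked over `G` if some
irreducible character `χ` of `G` satisfies `⟨χ|_H, α⟩ ≠ 0` and `⟨χ|_H, β⟩ ≠ 0`. -/
def Linked {G : Type} [Group G] (H : Subgroup G) (α β : ↥H → ℂ) : Prop :=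
  ∃ χ : G → ℂ, IsIrrChar G χ ∧
    charInner ↥H (resChar H χ) α ≠ 0 ∧ charInner ↥H (resChar H χ) β ≠ 0

/-- `α` and `β` are joined by a path of length at most `m` in the Külshammer graph
`K(G,H)`: there is a chain of irreducible characters of `H`, of length `k ≤ m`, from `α`
to `β` in which consecutive members are linked over `G`. -/
def LinkedPathLE {G : Type} [Group G] (H : Subgroup G) (m : ℕ) (α β : ↥H → ℂ) : Prop :=
  ∃ k ≤ m, ∃ f : ℕ → (↥H → ℂ), f 0 = α ∧ f k = β ∧
    (∀ i ≤ k, IsIrrChar ↥H (f i)) ∧ ∀ i < k, Linked H (f i) (f (i + 1))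

/-- The conjugate subgroup `g H g⁻¹`. -/
def conjSub {G : Type} [Group G] (g : G) (H : Subgroup G) : Subgroup G :=
  H.map (MulAut.conj g).toMonoidHom

open scoped MonoidAlgebra

open scoped ComplexOrder in
/-- Complex conjugation of a character value is evaluation at the inverse. -/
theorem Representation.star_character {H V : Type*} [Group H] [Finite H] [AddCommGroup V]
    [Module ℂ V] [FiniteDimensional ℂ V] (ρ : Representation ℂ H V) (h : H) :
    (starRingEnd ℂ) (ρ.character h) = ρ.character h⁻¹ := by
  classical
  have := Fintype.ofFinite H
  let b := Module.finBasis ℂ V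
  let M : H → Matrix _ _ ℂ := fun g => LinearMap.toMatrix b b (ρ g)
  have hM (g k : H) : M (g * k) = M g * M k := by
    simp only [M, map_mul, LinearMap.toMatrix_mul]
  have hM1 : M 1 = 1 := by simp [M]
  let P := ∑ g, (M g).conjTranspose * M g
  have hP : P.PosDef := by
    have : P = 1 + ∑ g ∈ Finset.univ.erase 1, (M g).conjTranspose * M g := by
      simp only [P]
      rw [← Finset.add_sum_erase _ _ (Finset.mem_univ 1), hM1]
      simp
    rw [this]
    exact Matrix.PosDef.one.add_posSemidef
      (Matrix.posSemidef_sum _ fun g _ => Matrix.posSemidef_conjTranspose_mul_self _)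
  have hinv : (M h).conjTranspose * P * M h = P := by
    simp only [P, Finset.mul_sum, Finset.sum_mul]
    refine Fintype.sum_equiv (Equiv.mulRight h) _ _ fun g => ?_
    simp [hM, Matrix.mul_assoc]
  have hu : IsUnit P.det := (Matrix.isUnit_iff_isUnit_det _).mp hP.isUnit
  have hh : M h * M h⁻¹ = 1 := by rw [← hM, mul_inv_cancel, hM1]
  have key : (M h).conjTranspose = P * M h⁻¹ * P⁻¹ := by
    calc (M h).conjTranspose
        = (M h).conjTranspose * P * (M h * M h⁻¹) * P⁻¹ := by
          rw [hh, Matrix.mul_one, Matrix.mul_assoc, Matrix.mul_nonsing_inv _ hu, Matrix.mul_one]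
      _ = P * M h⁻¹ * P⁻¹ := by rw [← Matrix.mul_assoc, hinv]
  have htr (g : H) : ρ.character g = (M g).trace := by
    rw [Representation.character, LinearMap.trace_eq_matrix_trace ℂ b]
  rw [htr, htr, starRingEnd_apply, ← Matrix.trace_conjTranspose, key, Matrix.mul_assoc,
    Matrix.trace_mul_comm, Matrix.mul_assoc, Matrix.nonsing_inv_mul _ hu, Matrix.mul_one]

/-- A nonzero element of the complex group algebra of a finite group acts nontrivially on some
irreducible representation. -/
theorem exists_irreducible_asAlgebraHom_ne_zero {G : Type} [Group G] [Finite G]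
    (r : MonoidAlgebra ℂ G) (hr : r ≠ 0) :
    ∃ (V : Type) (_ : AddCommGroup V) (_ : Module ℂ V) (_ : FiniteDimensional ℂ V)
      (ρ : Representation ℂ G V), ρ.IsIrreducible ∧ ∃ v, ρ.asAlgebraHom r v ≠ 0 := by
  have : NeZero (Nat.card G : ℂ) := ⟨Nat.cast_ne_zero.mpr Nat.card_pos.ne'⟩
  obtain ⟨S, hS, v, hvS, hv⟩ : ∃ S : Submodule (MonoidAlgebra ℂ G) (MonoidAlgebra ℂ G),
      IsSimpleModule (MonoidAlgebra ℂ G) S ∧ ∃ v ∈ S, r * v ≠ 0 := by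
    by_contra! hcon
    have h1 : (1 : MonoidAlgebra ℂ G) ∈
        sSup {m : Submodule (MonoidAlgebra ℂ G) (MonoidAlgebra ℂ G) |
          IsSimpleModule (MonoidAlgebra ℂ G) m} := by
      rw [IsSemisimpleModule.sSup_simples_eq_top]; trivial
    have : r * 1 = 0 := by
      rw [sSup_eq_iSup'] at h1
      exact Submodule.iSup_induction (motive := fun w => r * w = 0) _ h1
        (fun S v hv => hcon S S.2 v hv) (by simp)
        fun a b ha hb => by rw [mul_add, ha, hb, add_zero]
    exact hr (by simpa using this)
  have hact (r : MonoidAlgebra ℂ G) (w : S) :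
      (Representation.ofModule' S).asAlgebraHom r w = r • w := by
    have : (Representation.ofModule' S).asAlgebraHom = Algebra.lsmul ℂ ℂ (A := ℂ[G]) S :=
      (MonoidAlgebra.lift ℂ (S →ₗ[ℂ] S) G).apply_symm_apply _
    rw [this]; rfl
  refine ⟨S, inferInstance, inferInstance, Module.Finite.trans (MonoidAlgebra ℂ G) _,
    Representation.ofModule' S, ?_, ⟨v, hvS⟩, ?_⟩
  · rw [Representation.irreducible_iff_isSimpleModule_asModule]
    let e : (Representation.ofModule' (k := ℂ) (G := G) S).asModule ≃ₗ[MonoidAlgebra ℂ G] S :=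
      { (Representation.ofModule' S).asModuleEquiv with
        map_smul' := fun r w => by
          exact hact r _ }
    exact IsSimpleModule.congr e
  · rw [hact]
    exact fun h => hv (congrArg Subtype.val h)

/-- The character of an irreducible representation is an irreducible character. -/
theorem isIrrChar_character {G : Type} [Group G] [Finite G] {V : Type} [AddCommGroup V]
    [Module ℂ V] [FiniteDimensional ℂ V] (ρ : Representation ℂ G V) (hρ : ρ.IsIrreducible) :
    IsIrrChar G ρ.character := by
  have : NeZero (Nat.card G : ℂ) := ⟨Nat.cast_ne_zero.mpr Nat.card_pos.ne'⟩
  refine ⟨FDRep.of ρ, ?_, rfl⟩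
  rw [FDRep.simple_iff_end_is_rank_one,
    ← (Representation.linHom.invariantsEquivFDRepHom (FDRep.of ρ) (FDRep.of ρ)).finrank_eq,
    (Representation.invariantsEquivIntertwiningMap _ _).finrank_eq]
  exact Representation.IsIrreducible.finrank_intertwiningMap_self ρ

/-- A nonzero intertwining map into a restricted representation makes the inner product of the
characters nonzero. -/
theorem charInner_ne_zero_of_intertwining {G : Type} [Group G] (H : Subgroup G)
    [Finite H] {A V : Type} [AddCommGroup A] [Module ℂ A] [FiniteDimensional ℂ A] [AddCommGroup V]
    [Module ℂ V] [FiniteDimensional ℂ V] (α : Representation ℂ H A) (ρ : Representation ℂ G V)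
    (f : A →ₗ[ℂ] V) (hf : ∀ (h : H) a, f (α h a) = ρ h (f a)) (hne : f ≠ 0) :
    charInner H (resChar H ρ.character) α.character ≠ 0 := by
  classical
  have := Fintype.ofFinite H
  have hc : (Nat.card H : ℂ) ≠ 0 := Nat.cast_ne_zero.mpr Nat.card_pos.ne'
  let _ : Invertible (Nat.card H : ℂ) := invertibleOfNonzero hc
  let σ : Representation ℂ H V := ρ.comp H.subtype
  have key : charInner H (resChar H ρ.character) α.character
      = Module.finrank ℂ (Representation.IntertwiningMap α σ) := by
    rw [← Representation.card_inv_mul_sum_char_mul_char_eq_finrank, charInner,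
      finsum_eq_sum_of_fintype]
    simp only [Representation.star_character]
    rfl
  let F : Representation.IntertwiningMap α σ := f.intertwiningMap_of_isIntertwiningMap α σ hf
  have hF : F ≠ 0 := fun h => hne (congrArg Representation.IntertwiningMap.toLinearMap h)
  have : Module.Finite ℂ (Representation.IntertwiningMap α σ) :=
    Module.Finite.equiv (Representation.invariantsEquivIntertwiningMap α σ)
  rw [key]
  have := (Module.finrank_pos_iff_exists_ne_zero (R := ℂ)).mpr ⟨F, hF⟩
  exact_mod_cast this.ne'

/-- The group algebra element `∑ φ (h⁻¹ a) h` attached to a matrix coefficient. -/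
def coeffElement {G : Type} [Group G] (H : Subgroup G) [Fintype H] {A : Type} [AddCommGroup A]
    [Module ℂ A] (α : Representation ℂ H A) (φ : Module.Dual ℂ A) (a : A) : MonoidAlgebra ℂ G :=
  ∑ h : H, MonoidAlgebra.single (h : G) (φ (α h⁻¹ a))

/-- If a matrix coefficient element of `α` acts nontrivially on `ρ`, then the restriction of `ρ`
contains a constituent of `α`. -/
theorem charInner_ne_zero_of_coeffElement {G : Type} [Group G] (H : Subgroup G)
    [Fintype H] {A V : Type} [AddCommGroup A] [Module ℂ A] [FiniteDimensional ℂ A] [AddCommGroup V]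
    [Module ℂ V] [FiniteDimensional ℂ V] (α : Representation ℂ H A) (ρ : Representation ℂ G V)
    (φ : Module.Dual ℂ A) (a : A) (v : V)
    (hv : ρ.asAlgebraHom (coeffElement H α φ a) v ≠ 0) :
    charInner H (resChar H ρ.character) α.character ≠ 0 := by
  have happ (a : A) : ρ.asAlgebraHom (coeffElement H α φ a) v =
      ∑ h : H, φ (α h⁻¹ a) • ρ h v := by
    simp [coeffElement, map_sum, Representation.asAlgebraHom_single]
  let f : A →ₗ[ℂ] V := ∑ h : H, (φ ∘ₗ α h⁻¹).smulRight (ρ h v)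
  have hfapp (a : A) : f a = ∑ h : H, φ (α h⁻¹ a) • ρ h v := by simp [f]
  refine charInner_ne_zero_of_intertwining H α ρ f (fun k a => ?_) ?_
  · rw [hfapp, hfapp, map_sum]
    refine (Fintype.sum_equiv (Equiv.mulLeft k) _ _ fun h => ?_).symm
    simp only [Equiv.coe_mulLeft, mul_inv_rev, map_smul]
    rw [← Module.End.mul_apply (α _) (α k), ← map_mul, inv_mul_cancel_right,
      ← Module.End.mul_apply (ρ _) (ρ _), ← map_mul]
    rfl
  · intro h0
    apply hv
    rw [happ, ← hfapp, h0, LinearMap.zero_apply]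

/-- If some product of matrix coefficient elements is nonzero, the characters are linked. -/
theorem linked_of_coeffElement_mul_ne_zero {G : Type} [Group G] [Finite G] (H : Subgroup G)
    [Fintype H] {A B : Type} [AddCommGroup A] [Module ℂ A] [FiniteDimensional ℂ A] [AddCommGroup B]
    [Module ℂ B] [FiniteDimensional ℂ B] (α : Representation ℂ H A) (β : Representation ℂ H B)
    (φ : Module.Dual ℂ A) (a : A) (ψ : Module.Dual ℂ B) (b : B) (x : G)
    (hne : coeffElement H α φ a * MonoidAlgebra.single x 1 * coeffElement H β ψ b ≠ 0) :
    Linked H α.character β.character := by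
  obtain ⟨V, _, _, _, ρ, hρ, v, hv⟩ := exists_irreducible_asAlgebraHom_ne_zero _ hne
  rw [map_mul, map_mul, Module.End.mul_apply, Module.End.mul_apply] at hv
  refine ⟨ρ.character, isIrrChar_character ρ hρ,
    charInner_ne_zero_of_coeffElement H α ρ φ a _ hv,
    charInner_ne_zero_of_coeffElement H β ρ ψ b v fun h0 => hv ?_⟩
  rw [h0, map_zero, map_zero]

/-- The coefficient at `x` of `∑ φ (h⁻¹ a) h * x * ∑ ψ (k⁻¹ b) k`. -/
theorem coeffElement_mul_apply {G : Type} [Group G] (H : Subgroup G)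
    [Fintype H] {A B : Type} [AddCommGroup A] [Module ℂ A] [AddCommGroup B]
    [Module ℂ B] (α : Representation ℂ H A) (β : Representation ℂ H B)
    (φ : Module.Dual ℂ A) (a : A) (ψ : Module.Dual ℂ B) (b : B) (x : G) [DecidableEq G] :
    (coeffElement H α φ a * MonoidAlgebra.single x 1 * coeffElement H β ψ b).coeff x =
      ∑ h : H, ∑ k : H, if (h : G) * x * k = x then φ (α h⁻¹ a) * ψ (β k⁻¹ b) else 0 := by
  simp only [coeffElement, Finset.sum_mul, Finset.mul_sum, MonoidAlgebra.single_mul_single, mul_one]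
  simp only [MonoidAlgebra.coeff_sum, Finsupp.finsetSum_apply, MonoidAlgebra.coeff_single,
    Finsupp.single_apply]
  rw [Finset.sum_comm]

/-- If `H ∩ x H x⁻¹` is contained in `{1, z}` for an involution `z`, two characters of `H` are
linked unless `z` and `x⁻¹ z x` act by opposite scalars. -/
theorem linked_or_scalar {G : Type} [Group G] [Finite G] (H : Subgroup G)
    {A B : Type} [AddCommGroup A] [Module ℂ A] [FiniteDimensional ℂ A] [Nontrivial A]
    [AddCommGroup B] [Module ℂ B] [FiniteDimensional ℂ B] [Nontrivial B]
    (α : Representation ℂ H A) (β : Representation ℂ H B) (x z : G) (hz : z * z = 1)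
    (hx : ∀ g ∈ H, x⁻¹ * g * x ∈ H → g = 1 ∨ g = z) :
    Linked H α.character β.character ∨
      ∃ (h₁ : z ∈ H) (h₂ : x⁻¹ * z * x ∈ H) (ε : ℂ), ε * ε = 1 ∧
        α ⟨z, h₁⟩ = ε • 1 ∧ β ⟨x⁻¹ * z * x, h₂⟩ = (-ε) • 1 := by
  classical
  have := Fintype.ofFinite H
  by_cases hl : Linked H α.character β.character
  · exact Or.inl hl
  refine Or.inr ?_
  have hcoeff (φ : Module.Dual ℂ A) (a : A) (ψ : Module.Dual ℂ B) (b : B) :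
      ∑ h : H, ∑ k : H, (if (h : G) * x * k = x then φ (α h⁻¹ a) * ψ (β k⁻¹ b) else 0) = 0 := by
    rw [← coeffElement_mul_apply]
    by_contra h
    exact hl (linked_of_coeffElement_mul_ne_zero H α β φ a ψ b x fun h0 => h (by rw [h0]; simp))
  have hinner (h k : H) (hk : (h : G) * x * k = x) (F : H → ℂ) :
      ∑ k : H, (if (h : G) * x * k = x then F k else 0) = F k := by
    rw [Fintype.sum_eq_single k, if_pos hk]
    intro k' hk'
    rw [if_neg]
    exact fun h' => hk' (Subtype.ext (mul_left_cancel (h'.trans hk.symm)))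
  have hzero (h : H) (F : H → ℂ) (h1 : h ≠ 1) (h2 : (h : G) = z → x⁻¹ * z * x ∉ H) :
      ∑ k : H, (if (h : G) * x * k = x then F k else 0) = 0 := by
    refine Finset.sum_eq_zero fun k _ => if_neg fun hk => ?_
    have hk' : x⁻¹ * h * x = (k : G)⁻¹ := by
      rw [mul_assoc, inv_mul_eq_iff_eq_mul, eq_mul_inv_iff_mul_eq, hk]
    have hmem : x⁻¹ * h * x ∈ H := by rw [hk']; exact inv_mem k.2
    rcases hx h h.2 hmem with h' | h'
    · exact h1 (Subtype.ext h')
    · exact h2 h' (h' ▸ hmem)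
  obtain ⟨a₀, ha₀⟩ := exists_ne (0 : A)
  obtain ⟨b₀, hb₀⟩ := exists_ne (0 : B)
  obtain ⟨φ₀, hφ₀⟩ : ∃ φ : Module.Dual ℂ A, φ a₀ ≠ 0 := by
    by_contra! h
    exact ha₀ ((Module.forall_dual_apply_eq_zero_iff ℂ a₀).mp h)
  obtain ⟨ψ₀, hψ₀⟩ : ∃ ψ : Module.Dual ℂ B, ψ b₀ ≠ 0 := by
    by_contra! h
    exact hb₀ ((Module.forall_dual_apply_eq_zero_iff ℂ b₀).mp h)
  by_cases hgood : z ∈ H ∧ x⁻¹ * z * x ∈ H ∧ z ≠ 1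
  · obtain ⟨h₁, h₂, hz1⟩ := hgood
    have hzi : z⁻¹ = z := inv_eq_of_mul_eq_one_left hz
    have hrel (φ : Module.Dual ℂ A) (a : A) (ψ : Module.Dual ℂ B) (b : B) :
        φ a * ψ b + φ (α ⟨z, h₁⟩ a) * ψ (β ⟨x⁻¹ * z * x, h₂⟩ b) = 0 := by
      have h := hcoeff φ a ψ b
      rw [Fintype.sum_eq_add (1 : H) ⟨z, h₁⟩ (fun h => hz1 (congrArg Subtype.val h).symm)
        fun h hh => hzero h _ hh.1 fun h' => absurd (Subtype.ext h') hh.2,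
        hinner 1 1 (by simp), hinner ⟨z, h₁⟩ ⟨x⁻¹ * z * x, h₂⟩
          (by simp [mul_assoc]; rw [← mul_assoc z z, hz, one_mul])] at h
      have e₁ : (⟨z, h₁⟩ : H)⁻¹ = ⟨z, h₁⟩ := Subtype.ext hzi
      have e₂ : (⟨x⁻¹ * z * x, h₂⟩ : H)⁻¹ = ⟨x⁻¹ * z * x, h₂⟩ :=
        Subtype.ext (by simp [mul_assoc, hzi])
      rw [e₁, e₂] at h
      simpa using h
    have hsq : ∀ a, α ⟨z, h₁⟩ (α ⟨z, h₁⟩ a) = a := fun a => by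
      rw [← Module.End.mul_apply, ← map_mul]
      have : (⟨z, h₁⟩ * ⟨z, h₁⟩ : H) = 1 := Subtype.ext hz
      simp [this]
    let c : ℂ := (ψ₀ b₀)⁻¹ * ψ₀ (β ⟨x⁻¹ * z * x, h₂⟩ b₀)
    have hA (a : A) : a = (-c) • α ⟨z, h₁⟩ a := by
      rw [← sub_eq_zero, ← Module.forall_dual_apply_eq_zero_iff ℂ]
      intro φ
      have := hrel φ a ψ₀ b₀
      simp only [c, map_sub, map_smul, smul_eq_mul]
      field_simp
      linear_combination this
    have hc : c * c = 1 := by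
      have h1 : a₀ = (c * c) • a₀ := by
        have h2 := hA (α ⟨z, h₁⟩ a₀)
        rw [hsq] at h2
        calc a₀ = (-c) • α ⟨z, h₁⟩ a₀ := hA a₀
          _ = _ := by rw [h2, smul_smul, neg_mul_neg]
      have h3 : (c * c - 1) • a₀ = 0 := by rw [sub_smul, one_smul, ← h1, sub_self]
      exact sub_eq_zero.mp ((smul_eq_zero.mp h3).resolve_right ha₀)
    have hA' : α ⟨z, h₁⟩ = (-c) • 1 := by
      ext a
      have h2 := hA (α ⟨z, h₁⟩ a)
      rw [hsq] at h2
      simpa using h2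
    refine ⟨h₁, h₂, -c, by rw [neg_mul_neg, hc], hA', ?_⟩
    ext b
    rw [← sub_eq_zero, ← Module.forall_dual_apply_eq_zero_iff ℂ]
    intro ψ
    have := hrel φ₀ a₀ ψ b
    rw [hA'] at this
    simp only [LinearMap.smul_apply, Module.End.one_apply, map_smul, smul_eq_mul] at this
    have h4 : ψ b - c * ψ (β ⟨x⁻¹ * z * x, h₂⟩ b) = 0 :=
      (mul_eq_zero.mp (show φ₀ a₀ * _ = 0 by linear_combination this)).resolve_left hφ₀
    simp only [map_sub, LinearMap.smul_apply, Module.End.one_apply, map_smul, smul_eq_mul]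
    linear_combination (-c) * h4 - ψ (β ⟨x⁻¹ * z * x, h₂⟩ b) * hc
  · have h := hcoeff φ₀ a₀ ψ₀ b₀
    rw [Fintype.sum_eq_single (1 : H), hinner 1 1 (by simp)] at h
    · simp [hφ₀, hψ₀] at h
    · intro h hh
      refine hzero h _ hh fun h' hmem => hgood ⟨h' ▸ h.2, hmem, fun h1 => hh ?_⟩
      exact Subtype.ext (h'.trans h1)

/-- A subgroup meeting some conjugate of itself trivially has complete Külshammer graph. -/
theorem linked_of_trivial_intersection {G : Type} [Group G] [Finite G] (H : Subgroup G)
    {A B : Type} [AddCommGroup A] [Module ℂ A] [FiniteDimensional ℂ A] [Nontrivial A]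
    [AddCommGroup B] [Module ℂ B] [FiniteDimensional ℂ B] [Nontrivial B]
    (α : Representation ℂ H A) (β : Representation ℂ H B) (x : G)
    (hx : ∀ g ∈ H, x⁻¹ * g * x ∈ H → g = 1) : Linked H α.character β.character := by
  refine (linked_or_scalar H α β x 1 (mul_one 1) fun g h h' => Or.inl (hx g h h')).resolve_right ?_
  rintro ⟨h₁, h₂, ε, -, hA, hB⟩
  obtain ⟨a, ha⟩ := exists_ne (0 : A)
  obtain ⟨b, hb⟩ := exists_ne (0 : B)
  have e₁ : (⟨1, h₁⟩ : H) = 1 := rfl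
  have e₂ : (⟨x⁻¹ * 1 * x, h₂⟩ : H) = 1 := Subtype.ext (by simp)
  rw [e₁, map_one] at hA
  rw [e₂, map_one] at hB
  have hA' : (1 - ε) • a = 0 := by
    rw [sub_smul, one_smul, sub_eq_zero]; exact LinearMap.congr_fun hA a
  have hB' : (1 - -ε) • b = 0 := by
    rw [sub_smul, one_smul, sub_eq_zero]; exact LinearMap.congr_fun hB b
  have h3 := (smul_eq_zero.mp hA').resolve_right ha
  have h4 := (smul_eq_zero.mp hB').resolve_right hb
  have : (2 : ℂ) = 0 := by linear_combination h3 + h4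
  norm_num at this

/-- An irreducible character is afforded by a nonzero representation. -/
theorem IsIrrChar.exists_representation {H : Type} [Group H] {χ : H → ℂ} (h : IsIrrChar H χ) :
    ∃ (V : Type) (_ : AddCommGroup V) (_ : Module ℂ V) (_ : FiniteDimensional ℂ V)
      (_ : Nontrivial V) (ρ : Representation ℂ H V), χ = ρ.character := by
  obtain ⟨V, hV, rfl⟩ := h
  refine ⟨V, inferInstance, inferInstance, inferInstance, ?_, V.ρ, rfl⟩
  by_contra hn
  rw [not_nontrivial_iff_subsingleton] at hn
  apply CategoryTheory.id_nonzero V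
  ext v
  exact Subsingleton.elim _ _

/-- In a nilpotent permutation group every point that is moved shares its stabilizer with another
point of its orbit. -/
theorem exists_ne_smul_same_stabilizer {Ω : Type*} (H : Subgroup (Equiv.Perm Ω))
    [Group.IsNilpotent H] (i : Ω) (hi : ∃ h ∈ H, h i ≠ i) :
    ∃ m ∈ H, m i ≠ i ∧ ∀ h ∈ H, h i = i ↔ h (m i) = m i := by
  have hne : MulAction.stabilizer H i ≠ ⊤ := by
    obtain ⟨h, hh, hi⟩ := hi
    intro htop
    exact hi (MulAction.mem_stabilizer_iff.mp (htop ▸ Subgroup.mem_top (⟨h, hh⟩ : H)))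
  have hlt := Group.normalizerCondition_of_isNilpotent (MulAction.stabilizer H i) hne.lt_top
  obtain ⟨m, hmN, hmS⟩ := SetLike.exists_of_lt hlt
  refine ⟨m, m.2, fun h => hmS (MulAction.mem_stabilizer_iff.mpr h), fun h hh => ?_⟩
  have := Subgroup.mem_normalizer_iff''.mp hmN ⟨h, hh⟩
  rw [MulAction.mem_stabilizer_iff, MulAction.mem_stabilizer_iff] at this
  refine Iff.trans this ?_
  change (m : Equiv.Perm Ω)⁻¹ (h ((m : Equiv.Perm Ω) i)) = i ↔ _
  rw [Equiv.Perm.inv_eq_iff_eq, eq_comm (a := h _)]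

/-- If some point set splits a nilpotent group suitably, a cyclic rotation of the points that
keeps points with equal stabilizers together conjugates the group to one meeting it trivially. -/
theorem exists_conj_inf_trivial_of_invariant_set {n : ℕ} (H : Subgroup (Equiv.Perm (Fin n)))
    [Group.IsNilpotent H] (A : Set (Fin n)) (hA : ∀ h ∈ H, ∀ i, h i ∈ A ↔ i ∈ A)
    (hA1 : ∃ i, i ∈ A) (hA2 : ∃ i, i ∉ A)
    (hF : ∀ i, (∀ h ∈ H, h i = i) → i ∉ A ∧ ∀ j ∉ A, ∀ h ∈ H, h j = j) :
    ∃ x : Equiv.Perm (Fin n), ∀ g ∈ H, x⁻¹ * g * x ∈ H → g = 1 := by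
  classical
  obtain _ | m := n
  · exact hA1.choose.elim0
  let S : Setoid (Fin (m + 1)) :=
    { r := fun i j => ∀ h ∈ H, h i = i ↔ h j = j
      iseqv := ⟨fun _ _ _ => Iff.rfl, fun h g hg => (h g hg).symm,
        fun h h' g hg => (h g hg).trans (h' g hg)⟩ }
  let rep : Fin (m + 1) → ℕ := fun i => ((Quotient.mk S i).out : Fin (m + 1))
  let key : Fin (m + 1) → ℕ := fun i => (if i ∈ A then 0 else m + 1) + rep i
  have hrep_lt (i) : rep i < m + 1 := ((Quotient.mk S i).out : Fin (m + 1)).2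
  have hrep {i j} (h : rep i = rep j) : S.r i j := by
    have h' : (Quotient.mk S i).out = (Quotient.mk S j).out := Fin.ext h
    rw [Quotient.out_inj] at h'
    exact Quotient.exact h'
  have hkey {i j} (h : key i = key j) : S.r i j := by
    refine hrep ?_
    have h1 := hrep_lt i
    have h2 := hrep_lt j
    simp only [key] at h
    split_ifs at h <;> omega
  have hkey_le {i j} (h : key i ≤ key j) (hj : j ∈ A) : i ∈ A := by
    by_contra hi
    have h2 := hrep_lt j
    simp only [key, if_pos hj, if_neg hi] at h
    omega
  let s := Tuple.sort key
  have hs : Monotone (key ∘ s) := Tuple.monotone_sort key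
  let p : ℕ → Fin (m + 1) := fun k => s (Fin.ofNat (m + 1) k)
  have hp_surj (i) : ∃ k ≤ m, p k = i :=
    ⟨s.symm i, Nat.lt_succ_iff.mp (s.symm i).2, by simp [p]⟩
  have hp_mono {k l} (hkl : k ≤ l) (hl : l ≤ m) : key (p k) ≤ key (p l) := by
    refine hs ?_
    simp [Fin.le_def, Nat.mod_eq_of_lt, Nat.lt_succ_of_le hl, Nat.lt_succ_of_le (hkl.trans hl), hkl]
  let x : Equiv.Perm (Fin (m + 1)) := s * finRotate (m + 1) * s⁻¹
  have hx {k} (hk : k < m) : x (p k) = p (k + 1) := by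
    simp only [x, p, Equiv.Perm.mul_apply, Equiv.Perm.inv_def, Equiv.symm_apply_apply,
      finRotate_apply]
    congr 1
    ext
    simp [Fin.val_add]
  have hx_last : x (p m) = p 0 := by
    simp only [x, p, Equiv.Perm.mul_apply, Equiv.Perm.inv_def, Equiv.symm_apply_apply,
      finRotate_apply]
    congr 1
    ext
    simp
  refine ⟨x, fun g hg hg' => ?_⟩
  have hconj (i) : x ((x⁻¹ * g * x) i) = g (x i) := by simp
  have h0A : p 0 ∈ A := by
    obtain ⟨i, hi⟩ := hA1
    obtain ⟨k, hk, rfl⟩ := hp_surj i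
    exact hkey_le (hp_mono k.zero_le hk) hi
  have hmA : p m ∉ A := by
    obtain ⟨i, hi⟩ := hA2
    obtain ⟨k, hk, rfl⟩ := hp_surj i
    exact fun h => hi (hkey_le (hp_mono hk le_rfl) h)
  have hfix0 : g (p 0) = p 0 := by
    obtain ⟨k, hk, hgk⟩ := hp_surj (g (p 0))
    obtain _ | k := k
    · exact hgk.symm
    exfalso
    have h1 : p (k + 1) ∈ A := by rw [hgk, hA g hg]; exact h0A
    have h2 : p k ∈ A := hkey_le (hp_mono k.le_succ hk) h1
    rw [← hx (by omega), ← hx_last, ← hconj, x.apply_eq_iff_eq] at hgk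
    rw [hgk, hA _ hg'] at h2
    exact hmA h2
  have hstep {k} (hk : k < m) (hgk : g (p k) = p k) : g (p (k + 1)) = p (k + 1) := by
    by_cases hfix : ∀ h ∈ H, h (p k) = p k
    · obtain ⟨h1, h2⟩ := hF _ hfix
      exact h2 _ (fun h => h1 (hkey_le (hp_mono k.le_succ hk) h)) g hg
    push Not at hfix
    obtain ⟨c, hc, hne, hstab⟩ := exists_ne_smul_same_stabilizer H (p k) hfix
    have hceq : key (c (p k)) = key (p k) := by
      have : Quotient.mk S (c (p k)) = Quotient.mk S (p k) :=
        Quotient.sound fun h hh => (hstab h hh).symm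
      simp only [key, rep, this, hA c hc]
    obtain ⟨l, hl, hpl⟩ := hp_surj (c (p k))
    rw [← hpl] at hceq hne
    obtain hlk | hlk | hlk := lt_trichotomy l k
    · have h1 : S.r (p (k - 1)) (p k) := hkey (le_antisymm (hp_mono (by omega) hk.le)
        (hceq ▸ hp_mono (by omega) (by omega)))
      have h2 : x (p (k - 1)) = p k := by
        rw [hx (by omega)]; congr 1; omega
      have h3 : (x⁻¹ * g * x) (p (k - 1)) = p (k - 1) := by
        rw [← x.apply_eq_iff_eq, hconj, h2, hgk]
      have h4 := (h1 _ hg').mp h3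
      rw [← x.apply_eq_iff_eq, hconj, hx hk] at h4
      exact h4
    · exact absurd (by rw [hlk]) hne
    · have h1 : S.r (p k) (p (k + 1)) := hkey (le_antisymm (hp_mono (by omega) hk)
        (hceq ▸ hp_mono hlk hl))
      exact (h1 g hg).mp hgk
  have hall (k) (hk : k ≤ m) : g (p k) = p k := by
    induction k with
    | zero => exact hfix0
    | succ k ih => exact hstep hk (ih (by omega))
  ext i
  obtain ⟨k, hk, rfl⟩ := hp_surj i
  rw [hall k hk]; rfl

/-- A nontrivial intransitive nilpotent permutation group meets some conjugate of itself
trivially. -/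
theorem exists_conj_inf_trivial_of_intransitive {n : ℕ} (H : Subgroup (Equiv.Perm (Fin n)))
    [Group.IsNilpotent H] (hne : H ≠ ⊥) (hH : ¬ ∀ i j : Fin n, ∃ h ∈ H, h i = j) :
    ∃ x : Equiv.Perm (Fin n), ∀ g ∈ H, x⁻¹ * g * x ∈ H → g = 1 := by
  by_cases hF : ∃ i, ∀ h ∈ H, h i = i
  · refine exists_conj_inf_trivial_of_invariant_set H {i | ¬ ∀ h ∈ H, h i = i} ?_ ?_
      (hF.imp fun i hi => not_not.mpr hi) fun i hi =>
        ⟨not_not.mpr hi, fun j hj => not_not.mp hj⟩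
    · intro h hh i
      refine not_congr ⟨fun hi k hk => ?_, fun hi => by rwa [hi h hh]⟩
      have h1 : i = h i := by simpa using hi h⁻¹ (inv_mem hh)
      rw [h1]
      exact hi k hk
    · by_contra hc
      refine hne ((Subgroup.eq_bot_iff_forall _).mpr fun h hh => Equiv.ext fun i => ?_)
      exact not_not.mp (not_exists.mp hc i) h hh
  · push Not at hF hH
    obtain ⟨i, j, hij⟩ := hH
    refine exists_conj_inf_trivial_of_invariant_set H {k | ∃ h ∈ H, h i = k} ?_
      ⟨i, 1, one_mem H, rfl⟩ ⟨j, fun ⟨h, hh, hj⟩ => hij h hh hj⟩ fun k hk => ?_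
    · rintro h hh k
      constructor
      · rintro ⟨c, hc, hk⟩
        exact ⟨h⁻¹ * c, mul_mem (inv_mem hh) hc, by simp [hk]⟩
      · rintro ⟨c, hc, rfl⟩
        exact ⟨h * c, mul_mem hh hc, rfl⟩
    · obtain ⟨h, hh, hne⟩ := hF k
      exact absurd (hk h hh) hne

/-- A finite nilpotent group has a central element of order `p` for every prime `p` dividing its
order. -/
theorem exists_central_orderOf_eq {H : Type*} [Group H] [Finite H] [Group.IsNilpotent H] (p : ℕ)
    [hp : Fact p.Prime] (hpd : p ∣ Nat.card H) : ∃ z ∈ Subgroup.center H, orderOf z = p := by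
  classical
  obtain ⟨e⟩ := (Group.isNilpotent_of_finite_tfae (G := H).out 0 4 rfl rfl).mp ‹_›
  let q : (Nat.card H).primeFactors :=
    ⟨p, Nat.mem_primeFactors.mpr ⟨hp.out, hpd, Nat.card_pos.ne'⟩⟩
  let P : Sylow p H := default
  have hPd : p ∣ Nat.card P := P.dvd_card_of_dvd_card hpd
  have : Nontrivial P := by
    rw [← Finite.one_lt_card_iff_nontrivial]
    exact hp.out.one_lt.trans_le (Nat.le_of_dvd Nat.card_pos hPd)
  have hc : p ∣ Nat.card (Subgroup.center P) := by
    have := P.isPGroup'.center_nontrivial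
    obtain ⟨k, hk, hk'⟩ := ((P.isPGroup'.to_subgroup (Subgroup.center P)).nontrivial_iff_card).mp this
    rw [hk']
    exact dvd_pow_self p hk.ne'
  obtain ⟨z, hz⟩ := exists_prime_orderOf_dvd_card' p hc
  let f : ∀ p : (Nat.card H).primeFactors, ∀ P : Sylow p H, (↑P : Subgroup H) :=
    Pi.mulSingle q (Pi.mulSingle P (z : P))
  refine ⟨e f, ?_, ?_⟩
  · rw [Subgroup.mem_center_iff]
    intro g
    obtain ⟨g, rfl⟩ := e.surjective g
    rw [← map_mul, ← map_mul]
    congr 1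
    funext r R
    by_cases hr : r = q
    · subst hr
      by_cases hR : R = P
      · subst hR
        simpa [f] using Subgroup.mem_center_iff.mp z.2 _
      · simp [f, hR]
    · simp [f, hr]
  · have hzp : (z : P) ^ p = 1 := by
      rw [← Subgroup.coe_pow, orderOf_dvd_iff_pow_eq_one.mp hz.dvd, Subgroup.coe_one]
    have hz1 : (z : P) ≠ 1 := fun h => by
      rw [OneMemClass.coe_eq_one.mp h, orderOf_one] at hz
      exact hp.out.one_lt.ne hz
    refine orderOf_eq_prime ?_ fun h => hz1 ?_
    · rw [← map_pow]
      simp only [f]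
      rw [← Pi.mulSingle_pow, ← Pi.mulSingle_pow, hzp, Pi.mulSingle_one, Pi.mulSingle_one, map_one]
    · rw [map_eq_one_iff e e.injective] at h
      have := congrFun (congrFun h q) P
      simpa [f] using this

/-- A permutation of order `d` all of whose nontrivial powers are fixed point free is a disjoint
union of `d`-cycles. -/
theorem exists_equiv_prod_zmod {Ω : Type*} [Finite Ω] (σ : Equiv.Perm Ω) (d : ℕ) [NeZero d]
    (hσ : σ ^ d = 1) (hfree : ∀ (k : ℕ) (u : Ω), (σ ^ k) u = u → d ∣ k) :
    ∃ (c : ℕ) (e : Fin c × ZMod d ≃ Ω), ∀ j i, σ (e (j, i)) = e (j, i + 1) := by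
  classical
  let S := Equiv.Perm.SameCycle.setoid σ
  obtain ⟨c, ⟨q⟩⟩ := Finite.exists_equiv_fin (Quotient S)
  let f : Fin c × ZMod d → Ω := fun u => (σ ^ u.2.val) (q.symm u.1).out
  have hmod (k : ℕ) : σ ^ (k % d) = σ ^ k := by
    conv_rhs => rw [← Nat.mod_add_div k d, pow_add, pow_mul, hσ, one_pow, mul_one]
  have hinj : Function.Injective f := by
    rintro ⟨j, i⟩ ⟨j', i'⟩ h
    have hj : j = j' := by
      apply q.symm.injective
      rw [← Quotient.out_eq (q.symm j), ← Quotient.out_eq (q.symm j')]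
      refine Quotient.sound ((Equiv.Perm.sameCycle_pow_left (n := i.val)).mp ?_)
      change σ.SameCycle (f (j, i)) _
      rw [h]
      exact (Equiv.Perm.sameCycle_pow_left.mpr (Equiv.Perm.SameCycle.refl σ _))
    subst hj
    have key (a b : ℕ) (hab : a ≤ b) (hb : b < d) (u : Ω) (h : (σ ^ a) u = (σ ^ b) u) : a = b := by
      have h1 : (σ ^ (b - a)) u = u := by
        apply (σ ^ a).injective
        rw [← Equiv.Perm.mul_apply, ← pow_add, h]
        congr 2
        omega
      have := Nat.eq_zero_of_dvd_of_lt (hfree _ _ h1) (by omega)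
      omega
    have hi : i = i' := by
      apply ZMod.val_injective d
      rcases le_total i.val i'.val with hle | hle
      · exact key _ _ hle (ZMod.val_lt i') _ h
      · exact (key _ _ hle (ZMod.val_lt i) _ h.symm).symm
    rw [hi]
  have hsurj : Function.Surjective f := by
    intro u
    have h : σ.SameCycle (Quotient.mk S u).out u := Quotient.exact (Quotient.out_eq (Quotient.mk S u))
    obtain ⟨k, -, hk⟩ := h.exists_pow_eq'
    refine ⟨(q (Quotient.mk S u), k), ?_⟩
    simp only [f, Equiv.symm_apply_apply, ZMod.val_natCast, hmod, hk]
  refine ⟨c, Equiv.ofBijective f ⟨hinj, hsurj⟩, fun j i => ?_⟩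
  change σ ((σ ^ i.val) _) = (σ ^ (i + 1).val) _
  rw [← Equiv.Perm.mul_apply, ← pow_succ', ← hmod (i.val + 1), ZMod.val_add,
    ZMod.val_one_eq_one_mod, Nat.add_mod_mod]

/-- The disjoint union of `c` cycles of length `d`. -/
def blockShift (c d : ℕ) : Equiv.Perm (Fin c × ZMod d) :=
  (Equiv.refl _).prodCongr (Equiv.addRight 1)

theorem blockShift_apply {c d : ℕ} (j : Fin c) (i : ZMod d) :
    blockShift c d (j, i) = (j, i + 1) := rfl

theorem ZMod.ofNat_ne_zero_of_lt {d : ℕ} (k : ℕ) (hk : 0 < k) (hkd : k < d) :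
    (k : ZMod d) ≠ 0 := by
  rw [Ne, ZMod.natCast_eq_zero_iff]
  exact fun h => absurd (Nat.le_of_dvd hk h) (by omega)

/-- A permutation commuting with `blockShift` and fixing a point fixes the row of that point. -/
theorem fixes_row_of_commute {c d : ℕ} [NeZero d] {g : Equiv.Perm (Fin c × ZMod d)}
    (hg : Commute g (blockShift c d)) (j : Fin c) (i₀ : ZMod d) (h : g (j, i₀) = (j, i₀))
    (i : ZMod d) : g (j, i) = (j, i) := by
  have hk (k : ℕ) : g (j, i₀ + k) = (j, i₀ + k) := by
    induction k with
    | zero => simpa using h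
    | succ k ih =>
      have := Equiv.congr_fun hg.eq (j, i₀ + k)
      simp only [Equiv.Perm.mul_apply, ih, blockShift_apply, add_assoc] at this
      simpa using this
  have := hk (i - i₀).val
  rw [ZMod.natCast_zmod_val] at this
  simpa using this

/-- The centralizer of a cycle of length at least five meets a conjugate of itself trivially. -/
theorem exists_conj_blockShift_of_one {d : ℕ} (hd : 5 ≤ d) :
    ∃ x : Equiv.Perm (Fin 1 × ZMod d), ∀ g, Commute g (blockShift 1 d) →
      Commute g (x * blockShift 1 d * x⁻¹) → g = 1 := by
  have : NeZero d := ⟨by omega⟩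
  have h1 : (1 : ZMod d) ≠ 0 := by simpa using ZMod.ofNat_ne_zero_of_lt (d := d) 1 (by omega) (by omega)
  have h2 : (2 : ZMod d) ≠ 0 := by simpa using ZMod.ofNat_ne_zero_of_lt (d := d) 2 (by omega) (by omega)
  have h3 : (3 : ZMod d) ≠ 0 := by simpa using ZMod.ofNat_ne_zero_of_lt (d := d) 3 (by omega) (by omega)
  let x : Equiv.Perm (Fin 1 × ZMod d) := Equiv.swap (0, 0) (0, 1)
  let τ := x * blockShift 1 d * x⁻¹
  have hτ (i : ZMod d) : τ (0, i) = x (blockShift 1 d (x (0, i))) := by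
    simp [τ, x]
  have hx0 : x (0, 0) = (0, 1) := Equiv.swap_apply_left _ _
  have hx1 : x (0, 1) = (0, 0) := Equiv.swap_apply_right _ _
  have hx (i : ZMod d) (h : i ≠ 0) (h' : i ≠ 1) : x (0, i) = (0, i) :=
    Equiv.swap_apply_of_ne_of_ne (by simpa using h) (by simpa using h')
  have hS (i : ZMod d) : blockShift 1 d (τ (0, i)) = (0, i) ↔ i = 1 := by
    rw [hτ]
    by_cases hi0 : i = 0
    · subst hi0
      rw [hx0, blockShift_apply 0 1, one_add_one_eq_two, hx 2 h2 (by
        intro h; apply h1; linear_combination h), blockShift_apply]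
      simp only [Prod.mk.injEq, true_and]
      exact ⟨fun h => absurd (by linear_combination h) h3, fun h => absurd h.symm h1⟩
    by_cases hi1 : i = 1
    · subst hi1
      rw [hx1, blockShift_apply 0 0, zero_add, hx1, blockShift_apply 0 0, zero_add]
      simp
    rw [hx i hi0 hi1, blockShift_apply 0 i]
    simp only [hi1, iff_false]
    by_cases him : i + 1 = 0
    · rw [him, hx0, blockShift_apply]
      simp only [Prod.mk.injEq, true_and]
      exact fun h => h3 (by linear_combination him + h)
    · rw [hx (i + 1) him (by simpa using hi0), blockShift_apply]
      simp only [Prod.mk.injEq, true_and]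
      exact fun h => h2 (by linear_combination h)
  refine ⟨x, fun g hg hg' => ?_⟩
  have hfix : g (0, 1) = (0, 1) := by
    obtain ⟨i, hi⟩ : ∃ i, g (0, 1) = (0, i) := ⟨(g (0, 1)).2, Prod.ext (Subsingleton.elim _ _) rfl⟩
    have e := Equiv.congr_fun (hg.mul_right hg').eq (0, 1)
    simp only [Equiv.Perm.mul_apply] at e
    change g (blockShift 1 d (τ _)) = blockShift 1 d (τ _) at e
    rw [(hS 1).mpr rfl, hi] at e
    rw [hi, (hS i).mp e.symm]
  ext1 ⟨j, i⟩
  rw [Subsingleton.elim j 0]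
  exact fixes_row_of_commute hg 0 1 hfix i

/-- The centralizer of a disjoint union of at least two cycles of equal length at least three
meets a conjugate of itself trivially. -/
theorem exists_conj_blockShift_of_two_le {c d : ℕ} (hc : 2 ≤ c) (hd : 3 ≤ d) :
    ∃ x : Equiv.Perm (Fin c × ZMod d), ∀ g, Commute g (blockShift c d) →
      Commute g (x * blockShift c d * x⁻¹) → g = 1 := by
  classical
  have : NeZero d := ⟨by omega⟩
  obtain ⟨c, rfl⟩ : ∃ m, c = m + 2 := ⟨c - 2, by omega⟩
  have h1 : (1 : ZMod d) ≠ 0 := by simpa using ZMod.ofNat_ne_zero_of_lt (d := d) 1 (by omega) (by omega)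
  have h2 : (2 : ZMod d) ≠ 0 := by simpa using ZMod.ofNat_ne_zero_of_lt (d := d) 2 (by omega) (by omega)
  let σ := blockShift (c + 2) d
  let r : Equiv.Perm (Fin (c + 2) × ZMod d) :=
    Function.Involutive.toPerm (fun u => if u.1 = 0 then (u.1, -u.2) else u) fun u => by
      by_cases h : u.1 = 0 <;> simp [h]
      rw [← h]
  let y : Equiv.Perm (Fin (c + 2) × ZMod d) :=
    { toFun := fun u => if u.2 = 0 then (u.1 + 1, u.2) else u
      invFun := fun u => if u.2 = 0 then (u.1 - 1, u.2) else u
      left_inv := fun u => by by_cases h : u.2 = 0 <;> simp [h]; rw [← h]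
      right_inv := fun u => by by_cases h : u.2 = 0 <;> simp [h]; rw [← h] }
  have hy0 (j) : y (j, 0) = (j + 1, 0) := by simp [y]
  have hy (j) (i : ZMod d) (hi : i ≠ 0) : y (j, i) = (j, i) := by simp [y, hi]
  have hr0 (i : ZMod d) : r (0, i) = (0, -i) := by
    change (if (0 : Fin (c + 2)) = 0 then ((0 : Fin (c + 2)), -i) else (0, i)) = _
    exact if_pos rfl
  have hr (j) (i : ZMod d) (hj : j ≠ 0) : r (j, i) = (j, i) := if_neg hj
  let x := y * r
  let τ := x * σ * x⁻¹
  have hτx (u) : τ (x u) = x (σ u) := by simp [τ]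
  have hτ (j) (i : ZMod d) (hj : j ≠ 0) : τ (y (j, i)) = y (j, i + 1) := by
    have := hτx (j, i)
    simpa only [x, σ, Equiv.Perm.mul_apply, blockShift_apply, hr _ _ hj] using this
  have hτ0 (i : ZMod d) : τ (y (0, i)) = y (0, i - 1) := by
    have := hτx (0, -i)
    simp only [x, σ, Equiv.Perm.mul_apply, blockShift_apply, hr0, neg_neg] at this
    rw [this]
    congr 2
    ring
  have hS (j) (i : ZMod d) : τ (σ (j, i)) = (j, i) ↔ j = 0 ∧ i ≠ 0 ∧ i ≠ -1 := by
    rw [show σ (j, i) = (j, i + 1) from rfl]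
    by_cases hi : i + 1 = 0
    · have hi' : i = -1 := by linear_combination hi
      have : ((j, i + 1) : Fin (c + 2) × ZMod d) = y (j - 1, 0) := by simp [hy0, hi]
      rw [this]
      simp only [hi', ne_eq, not_true_eq_false, and_false, iff_false]
      by_cases hj : j - 1 = 0
      · rw [hj, hτ0, zero_sub, hy _ _ (neg_ne_zero.mpr h1), sub_eq_zero.mp hj]
        simp
      · rw [hτ _ _ hj, zero_add, hy _ _ h1]
        simp
    · have hi' : i ≠ -1 := fun h => hi (by rw [h]; ring)
      rw [← hy _ _ hi]
      by_cases hj : j = 0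
      · subst hj
        rw [hτ0, add_sub_cancel_right]
        by_cases hi0 : i = 0
        · simp [hi0, hy0]
        · simp [hi0, hi', hy]
      · rw [hτ _ _ hj]
        simp only [hj, false_and, iff_false]
        intro h
        have h3 : (y (j, i + 1 + 1)).2 = i + 1 + 1 := by
          by_cases h4 : i + 1 + 1 = 0
          · rw [h4, hy0]
          · rw [hy _ _ h4]
        rw [h] at h3
        exact h2 (by linear_combination -h3)
  refine ⟨x, fun g hg hg' => ?_⟩
  have hgσ (u) : g (σ u) = σ (g u) := Equiv.congr_fun hg.eq u
  have hgτ (u) : g (τ u) = τ (g u) := Equiv.congr_fun hg'.eq u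
  have hginv (u) : τ (σ (g u)) = g u ↔ τ (σ u) = u := by
    rw [← hgσ, ← hgτ, g.apply_eq_iff_eq]
  have hstart : g (0, 1) = (0, 1) := by
    obtain ⟨⟨j, i⟩, hji⟩ : ∃ u, g (0, 0) = u := ⟨_, rfl⟩
    have e1 : g (0, 1) = (j, i + 1) := by
      have := hgσ (0, 0)
      rwa [hji, blockShift_apply, zero_add] at this
    have hm1 : (1 : ZMod d) ≠ -1 := fun h => h2 (by linear_combination h)
    have h3 := (hginv (0, 1)).mpr ((hS 0 1).mpr ⟨rfl, h1, hm1⟩)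
    have h4 : ¬ τ (σ (j, i)) = (j, i) := by
      rw [← hji, hginv, hS]; simp
    rw [e1, hS] at h3
    rw [hS] at h4
    obtain ⟨rfl, h5, h6⟩ := h3
    rw [e1]
    have : i = 0 := by
      by_contra h7
      exact h4 ⟨rfl, h7, fun h8 => h5 (by rw [h8]; ring)⟩
    rw [this, zero_add]
  have hnext (j) (h : g (j, 1) = (j, 1)) : g (j + 1, 0) = (j + 1, 0) := by
    rw [← hy0]
    rw [← hy _ _ h1] at h
    by_cases hj : j = 0
    · subst hj
      have := hgτ (y (0, 1))
      rwa [h, hτ0, sub_self] at this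
    · apply τ.injective
      rw [← hgτ, hτ _ _ hj, zero_add, h]
  have hrow (j) (i : ZMod d) : g (j, i) = (j, i) := by
    induction j using Fin.induction generalizing i with
    | zero => exact fixes_row_of_commute hg _ 1 hstart i
    | succ k ih =>
      refine fixes_row_of_commute hg _ 0 ?_ i
      rw [← Fin.coeSucc_eq_succ]
      exact hnext _ (ih 1)
  ext1 ⟨j, i⟩
  exact hrow j i

/-- Transport along a labelling of the points. -/
theorem exists_conj_inf_trivial_of_labelling {Ω Ω' : Type*} (H : Subgroup (Equiv.Perm Ω))
    (e : Ω' ≃ Ω) (P : Equiv.Perm Ω' → Prop) (hP : ∀ h ∈ H, P (e.symm.permCongr h))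
    (hx : ∃ x : Equiv.Perm Ω', ∀ g, P g → P (x⁻¹ * g * x) → g = 1) :
    ∃ x : Equiv.Perm Ω, ∀ g ∈ H, x⁻¹ * g * x ∈ H → g = 1 := by
  obtain ⟨x, hx⟩ := hx
  refine ⟨e.permCongr x, fun g hg hg' => ?_⟩
  have h1 : e.symm.permCongr g = 1 := by
    refine hx _ (hP g hg) ?_
    convert hP _ hg' using 1
    ext i
    simp only [Equiv.permCongr_apply, Equiv.Perm.inv_def, Equiv.Perm.mul_apply, Equiv.symm_symm,
      Equiv.symm_apply_apply]
    exact (e.symm_apply_apply _).symm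
  ext i
  have := Equiv.congr_fun h1 (e.symm i)
  simpa using this

/-- A central element of a transitive permutation group acts semiregularly. -/
theorem pow_eq_one_of_central_of_fixes {Ω : Type*} (H : Subgroup (Equiv.Perm Ω))
    (htr : ∀ i j : Ω, ∃ h ∈ H, h i = j) (σ : H) (hσ : σ ∈ Subgroup.center H) (k : ℕ) (u : Ω)
    (hu : ((σ : Equiv.Perm Ω) ^ k) u = u) : σ ^ k = 1 := by
  refine Subtype.ext (Equiv.ext fun v => ?_)
  obtain ⟨h, hh, rfl⟩ := htr u v
  have hc := Subgroup.mem_center_iff.mp (pow_mem hσ k) ⟨h, hh⟩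
  have hc' := Equiv.congr_fun (congrArg Subtype.val hc) u
  simp only [Subgroup.coe_mul, Subgroup.coe_pow, Equiv.Perm.mul_apply, hu] at hc'
  simpa using hc'.symm

/-- A central element of prime order in a transitive group, in coordinates. -/
theorem exists_labelling_of_central {Ω : Type*} [Finite Ω] (H : Subgroup (Equiv.Perm Ω))
    (htr : ∀ i j : Ω, ∃ h ∈ H, h i = j) (p : ℕ) [NeZero p] (σ : H)
    (hσ : σ ∈ Subgroup.center H) (hp : orderOf σ = p) :
    ∃ (c : ℕ) (e : Fin c × ZMod p ≃ Ω), e.symm.permCongr σ = blockShift c p := by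
  obtain ⟨c, e, he⟩ := exists_equiv_prod_zmod (σ : Equiv.Perm Ω) p
    (by rw [← Subgroup.coe_pow, ← hp, pow_orderOf_eq_one, Subgroup.coe_one])
    fun k u hu => hp ▸ orderOf_dvd_of_pow_eq_one (pow_eq_one_of_central_of_fixes H htr σ hσ k u hu)
  refine ⟨c, e, Equiv.ext fun ⟨j, i⟩ => ?_⟩
  simp [Equiv.permCongr_apply, he, blockShift_apply]

/-- A transitive nilpotent permutation group of degree at least five whose order has an odd prime
divisor meets some conjugate of itself trivially. -/
theorem exists_conj_inf_trivial_of_odd_prime {n : ℕ} (hn : 5 ≤ n)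
    (H : Subgroup (Equiv.Perm (Fin n))) [Group.IsNilpotent H]
    (htr : ∀ i j : Fin n, ∃ h ∈ H, h i = j) (p : ℕ) (hp : p.Prime) (hp2 : p ≠ 2)
    (hpd : p ∣ Nat.card H) :
    ∃ x : Equiv.Perm (Fin n), ∀ g ∈ H, x⁻¹ * g * x ∈ H → g = 1 := by
  have : Fact p.Prime := ⟨hp⟩
  obtain ⟨σ, hσ, hord⟩ := exists_central_orderOf_eq (H := H) p hpd
  obtain ⟨c, e, he⟩ := exists_labelling_of_central H htr p σ hσ hord
  have hcard : c * p = n := by simpa using Nat.card_congr e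
  have hp3 : 3 ≤ p := by have := hp.two_le; omega
  have hmain : ∃ x : Equiv.Perm (Fin c × ZMod p), ∀ g, Commute g (blockShift c p) →
      Commute g (x * blockShift c p * x⁻¹) → g = 1 := by
    obtain hc | hc | hc : c = 0 ∨ c = 1 ∨ 2 ≤ c := by omega
    · subst hc; omega
    · subst hc
      exact exists_conj_blockShift_of_one (by omega)
    · exact exists_conj_blockShift_of_two_le hc hp3
  refine exists_conj_inf_trivial_of_labelling H e (fun g => Commute g (blockShift c p))
    (fun h hh => ?_) ?_
  · rw [← he]
    have hc := congrArg Subtype.val (Subgroup.mem_center_iff.mp hσ ⟨h, hh⟩)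
    ext1 i
    simpa [Equiv.permCongr_apply] using congrArg e.symm (Equiv.congr_fun hc (e i))
  · obtain ⟨x, hx⟩ := hmain
    refine ⟨x, fun g hg hg' => hx g hg ?_⟩
    have := (Commute.conj_iff x).mpr hg'
    simpa [mul_assoc] using this

/-- A maximal subgroup of a finite `2`-group has index two. -/
theorem index_eq_two_of_isCoatom {H : Type*} [Group H] [Finite H] (hH : IsPGroup 2 H)
    (N : Subgroup H) [N.Normal] (hN : IsCoatom N) : N.index = 2 := by
  have hq : IsPGroup 2 (H ⧸ N) := hH.to_quotient N
  have : Nontrivial (H ⧸ N) := QuotientGroup.nontrivial_iff.mpr hN.1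
  obtain ⟨m, hm, hcard⟩ := hq.nontrivial_iff_card.mp this
  obtain ⟨z, hz⟩ := exists_prime_orderOf_dvd_card' (G := H ⧸ N) 2
    (hcard ▸ dvd_pow_self 2 hm.ne')
  have htop : Subgroup.zpowers z = ⊤ := by
    have hle : N ≤ (Subgroup.zpowers z).comap (QuotientGroup.mk' N) := by
      intro h hh
      rw [Subgroup.mem_comap, QuotientGroup.mk'_apply, (QuotientGroup.eq_one_iff h).mpr hh]
      exact one_mem _
    have h1 : (Subgroup.zpowers z).comap (QuotientGroup.mk' N) = ⊤ := by
      refine hN.2 _ (lt_of_le_of_ne hle fun h => ?_)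
      obtain ⟨k, rfl⟩ := QuotientGroup.mk'_surjective N z
      have : k ∈ N := by
        rw [h]
        exact Subgroup.mem_zpowers _
      rw [QuotientGroup.mk'_apply, (QuotientGroup.eq_one_iff k).mpr this, orderOf_one] at hz
      omega
    rw [← Subgroup.map_comap_eq_self_of_surjective (QuotientGroup.mk'_surjective N)
      (Subgroup.zpowers z), h1, Subgroup.map_top_of_surjective _ (QuotientGroup.mk'_surjective N)]
  rw [Subgroup.index_eq_card, ← Subgroup.card_top, ← htop, Nat.card_zpowers, hz]

/-- A transitive `2`-group with a central involution `σ` on more than two points preserves a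
partition of the points into two `σ`-invariant halves. -/
theorem exists_invariant_halves {Ω : Type*} [Finite Ω] (H : Subgroup (Equiv.Perm Ω))
    (hH : IsPGroup 2 H) (htr : ∀ i j : Ω, ∃ h ∈ H, h i = j) (hcard : 2 < Nat.card Ω) (σ : H)
    (hσ : σ ∈ Subgroup.center H) (hσ2 : orderOf σ = 2) :
    ∃ A : Set Ω, (∀ u, (σ : Equiv.Perm Ω) u ∈ A ↔ u ∈ A) ∧
      (∀ h ∈ H, ∀ u v, (h u ∈ A ↔ h v ∈ A) ↔ (u ∈ A ↔ v ∈ A)) ∧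
      ∃ h ∈ H, ∀ u, h u ∈ A ↔ u ∉ A := by
  classical
  have : Group.IsNilpotent H := hH.isNilpotent
  have := Fintype.ofFinite Ω
  rw [Nat.card_eq_fintype_card] at hcard
  obtain ⟨ω⟩ : Nonempty Ω := Fintype.card_pos_iff.mp (by omega)
  have hσσ (u) : (σ : Equiv.Perm Ω) ((σ : Equiv.Perm Ω) u) = u := by
    have h1 : σ * σ = 1 := by rw [← pow_two, ← hσ2, pow_orderOf_eq_one]
    exact Equiv.congr_fun (congrArg Subtype.val h1) u
  have hcomm (h : H) (u) : (h : Equiv.Perm Ω) ((σ : Equiv.Perm Ω) u) =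
      (σ : Equiv.Perm Ω) ((h : Equiv.Perm Ω) u) :=
    Equiv.congr_fun (congrArg Subtype.val (Subgroup.mem_center_iff.mp hσ h)) u
  let K : Subgroup H :=
    { carrier := {h | (h : Equiv.Perm Ω) ω = ω ∨ (h : Equiv.Perm Ω) ω = (σ : Equiv.Perm Ω) ω}
      one_mem' := Or.inl rfl
      mul_mem' := by
        rintro a b (ha | ha) (hb | hb)
        · left; simp [ha, hb]
        · right; simp [ha, hb, hcomm]
        · right; simp [ha, hb]
        · left; simp [ha, hb, hcomm, hσσ]
      inv_mem' := by
        rintro a (ha | ha)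
        · left
          simp only [Subgroup.coe_inv, Equiv.Perm.inv_eq_iff_eq, ha]
        · right
          simp only [Subgroup.coe_inv, Equiv.Perm.inv_eq_iff_eq, hcomm, ha, hσσ] }
  have hK : K ≠ ⊤ := by
    intro h
    obtain ⟨u, hu⟩ : ∃ u, u ∉ ({ω, (σ : Equiv.Perm Ω) ω} : Finset Ω) := by
      by_contra! hc
      have := Finset.card_le_card (fun u _ => hc u : Finset.univ ⊆ _)
      have h2 := Finset.card_le_two (a := ω) (b := (σ : Equiv.Perm Ω) ω)
      rw [Finset.card_univ] at this
      omega
    obtain ⟨k, hk, rfl⟩ := htr ω u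
    have : (⟨k, hk⟩ : H) ∈ K := h ▸ Subgroup.mem_top _
    exact hu (by simpa using (show k ω = ω ∨ k ω = (σ : Equiv.Perm Ω) ω from this))
  obtain ⟨N, hN, hKN⟩ := (eq_top_or_exists_le_coatom K).resolve_left hK
  have : N.Normal :=
    Subgroup.NormalizerCondition.normal_of_coatom N Group.normalizerCondition_of_isNilpotent hN
  have hidx := index_eq_two_of_isCoatom hH N hN
  let A : Set Ω := {u | ∃ h ∈ N, (h : Equiv.Perm Ω) ω = u}
  have hA (k : H) : (k : Equiv.Perm Ω) ω ∈ A ↔ k ∈ N := by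
    refine ⟨fun ⟨h, hh, he⟩ => ?_, fun hk => ⟨k, hk, rfl⟩⟩
    have h1 : h⁻¹ * k ∈ N := hKN (Or.inl (by
      simp only [Subgroup.coe_mul, Subgroup.coe_inv, Equiv.Perm.mul_apply, Equiv.Perm.inv_eq_iff_eq,
        he]))
    exact (Subgroup.mul_mem_cancel_left N (inv_mem hh)).mp h1
  have hmul (h k : H) : (h : Equiv.Perm Ω) ((k : Equiv.Perm Ω) ω) ∈ A ↔ (h ∈ N ↔ k ∈ N) := by
    rw [← Subgroup.mul_mem_iff_of_index_two hidx, ← hA]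
    rfl
  refine ⟨A, fun u => ?_, fun h hh u v => ?_, ?_⟩
  · obtain ⟨k, hk, rfl⟩ := htr ω u
    have hσN : σ ∈ N := hKN (Or.inr rfl)
    rw [hmul σ ⟨k, hk⟩, hA ⟨k, hk⟩]
    tauto
  · obtain ⟨k, hk, rfl⟩ := htr ω u
    obtain ⟨l, hl, rfl⟩ := htr ω v
    rw [hmul ⟨h, hh⟩ ⟨k, hk⟩, hmul ⟨h, hh⟩ ⟨l, hl⟩, hA ⟨k, hk⟩, hA ⟨l, hl⟩]
    tauto
  · obtain ⟨h, -, hh⟩ := SetLike.exists_of_lt hN.lt_top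
    refine ⟨h, h.2, fun u => ?_⟩
    obtain ⟨k, hk, rfl⟩ := htr ω u
    rw [hmul h ⟨k, hk⟩, hA ⟨k, hk⟩]
    tauto

/-- Permutations of `4 * s` points preserving the partition into consecutive pairs and the partition
into two halves. -/
def PreservesPairsAndHalves (s : ℕ) (g : Equiv.Perm (Fin (2 * s * 2))) : Prop :=
  (∀ i j, i.val / 2 = j.val / 2 → (g i).val / 2 = (g j).val / 2) ∧
    ∀ i j, ((g i).val < 2 * s ↔ (g j).val < 2 * s) ↔ (i.val < 2 * s ↔ j.val < 2 * s)

/-- A transitive `2`-group on `4 * s` points preserves pairs and halves in suitable coordinates. -/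
theorem exists_labelling_preservesPairsAndHalves {Ω : Type*} [Finite Ω]
    (H : Subgroup (Equiv.Perm Ω)) (hH : IsPGroup 2 H) (htr : ∀ i j : Ω, ∃ h ∈ H, h i = j) (s : ℕ)
    (hs : 0 < s) (hcard : Nat.card Ω = 2 * s * 2) :
    ∃ e : Fin (2 * s * 2) ≃ Ω, ∀ h ∈ H, PreservesPairsAndHalves s (e.symm.permCongr h) := by
  classical
  have : Group.IsNilpotent H := hH.isNilpotent
  have := Fintype.ofFinite Ω
  have hHnt : Nontrivial H := by
    have : Nontrivial Ω := Finite.one_lt_card_iff_nontrivial.mp (by omega)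
    obtain ⟨u, v, huv⟩ := exists_pair_ne Ω
    obtain ⟨h, hh, he⟩ := htr u v
    refine ⟨⟨h, hh⟩, 1, fun h1 => huv ?_⟩
    rw [← he, show h = 1 from congrArg Subtype.val h1]
    rfl
  obtain ⟨m, hm, hcardH⟩ := hH.nontrivial_iff_card.mp hHnt
  obtain ⟨σ, hσ, hσ2⟩ := exists_central_orderOf_eq (H := H) 2 (hcardH ▸ dvd_pow_self 2 hm.ne')
  obtain ⟨A, hAσ, hAH, h₀, hh₀, hA₀⟩ :=
    exists_invariant_halves H hH htr (by omega) σ hσ hσ2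
  obtain ⟨c, e, he⟩ := exists_labelling_of_central H htr 2 σ hσ hσ2
  have he' (u) : (σ : Equiv.Perm Ω) (e u) = e (u.1, u.2 + 1) := by
    have := Equiv.congr_fun he u
    rw [← e.apply_eq_iff_eq] at this
    simp only [Equiv.permCongr_apply, Equiv.symm_symm, Equiv.apply_symm_apply] at this
    exact this
  obtain rfl : c = 2 * s := by
    have : c * 2 = Nat.card Ω := by simpa using Nat.card_congr e
    omega
  have heA (u : Fin (2 * s) × ZMod 2) : e u ∈ A ↔ e (u.1, 0) ∈ A := by
    obtain ⟨j, i⟩ := u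
    obtain rfl | rfl : i = 0 ∨ i = 1 := by revert i; decide
    · rfl
    · have := hAσ (e (j, 0))
      rwa [he', zero_add] at this
  let B : Finset (Fin (2 * s)) := {j | e (j, 0) ∈ A}
  have hB : B.card = s := by
    have h1 : Fintype.card {u // u ∈ A} = Fintype.card {u // u ∉ A} := by
      refine (Fintype.card_congr (Equiv.subtypeEquiv h₀ fun u => ?_)).symm
      exact (hA₀ u).symm
    have h2 := Fintype.card_subtype_compl (fun u => u ∈ A)
    have h3 : Fintype.card {u // u ∈ A} = B.card * 2 := by
      have h4 : B.card * 2 = (B ×ˢ (Finset.univ : Finset (ZMod 2))).card := by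
        rw [Finset.card_product, Finset.card_univ, ZMod.card]
      rw [Fintype.card_subtype, h4]
      refine (Finset.card_bij (fun u _ => e u) (fun u hu => ?_) (fun _ _ _ _ h => e.injective h)
        fun u hu => ⟨e.symm u, ?_, by simp⟩).symm
      · have := (Finset.mem_product.mp hu).1
        simp only [B, Finset.mem_filter, Finset.mem_univ, true_and] at this ⊢
        exact (heA u).mpr this
      · simp only [B, Finset.mem_product, Finset.mem_filter, Finset.mem_univ, true_and, and_true]
          at hu ⊢
        rw [← heA]
        simpa using hu
    rw [Nat.card_eq_fintype_card] at hcard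
    have h4 := Fintype.card_subtype_le (fun u => u ∈ A)
    omega
  have hcardB : Fintype.card {j : Fin (2 * s) // j.val < s} = Fintype.card {j // j ∈ B} := by
    rw [Fintype.card_coe, hB, Fintype.card_subtype]
    exact (Fin.card_filter_val_lt).trans (by omega)
  let π : Equiv.Perm (Fin (2 * s)) := (Fintype.equivOfCardEq hcardB).extendSubtype
  have hπ (j) : π j ∈ B ↔ j.val < s := by
    refine ⟨fun h => ?_, fun h => Equiv.extendSubtype_mem _ j h⟩
    by_contra hj
    exact Equiv.extendSubtype_not_mem (Fintype.equivOfCardEq hcardB) j hj h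
  let f : Fin (2 * s * 2) ≃ Ω :=
    (finProdFinEquiv.symm.trans (π.prodCongr (ZMod.finEquiv 2).toEquiv)).trans e
  have hfσ (i j : Fin (2 * s * 2)) : i.val / 2 = j.val / 2 ↔
      f i = f j ∨ f i = (σ : Equiv.Perm Ω) (f j) := by
    have hf (i : Fin (2 * s * 2)) : f i = e (π i.divNat, ZMod.finEquiv 2 i.modNat) := rfl
    rw [hf, hf, he', e.apply_eq_iff_eq, e.apply_eq_iff_eq]
    simp only [Prod.mk.injEq, π.apply_eq_iff_eq]
    have h1 : i.divNat = j.divNat ↔ i.val / 2 = j.val / 2 := by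
      rw [Fin.ext_iff]; rfl
    have h2 : ∀ a b : ZMod 2, a = b ∨ a = b + 1 := by decide
    rw [← and_or_left, h1]
    exact (and_iff_left (h2 _ _)).symm
  have hfA (i : Fin (2 * s * 2)) : f i ∈ A ↔ i.val < 2 * s := by
    have hf : f i = e (π i.divNat, ZMod.finEquiv 2 i.modNat) := rfl
    have h1 := hπ i.divNat
    rw [hf, heA]
    simp only [B, Finset.mem_filter, Finset.mem_univ, true_and] at h1
    rw [h1]
    change i.val / 2 < s ↔ _
    omega
  refine ⟨f, fun h hh => ⟨fun i j hij => ?_, fun i j => ?_⟩⟩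
  · rw [hfσ] at hij ⊢
    simp only [Equiv.permCongr_apply, Equiv.symm_symm, Equiv.apply_symm_apply]
    refine hij.imp (fun h => by rw [h]) fun h' => ?_
    rw [h']
    exact Equiv.congr_fun (congrArg Subtype.val (Subgroup.mem_center_iff.mp hσ ⟨h, hh⟩)) _
  · rw [← hfA, ← hfA, ← hfA, ← hfA]
    simp only [Equiv.permCongr_apply, Equiv.symm_symm, Equiv.apply_symm_apply]
    exact hAH h hh _ _

/-- The permutation of `4 * s` points sending `i` to `i - 1`, followed by interchanging the two
pairs on either side of the middle. -/
theorem exists_shiftedSwap {s : ℕ} (hs : 3 ≤ s) : ∃ y : Equiv.Perm (Fin (2 * s * 2)), ∀ i,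
    (y i).val = if i.val = 0 then 4 * s - 1 else if i.val = 2 * s - 1 then 2 * s else
      if i.val = 2 * s then 2 * s + 1 else if i.val = 2 * s + 1 then 2 * s - 2 else
      if i.val = 2 * s + 2 then 2 * s - 1 else i.val - 1 := by
  let f : Fin (2 * s * 2) → Fin (2 * s * 2) := fun i =>
    ⟨if i.val = 0 then 4 * s - 1 else if i.val = 2 * s - 1 then 2 * s else
      if i.val = 2 * s then 2 * s + 1 else if i.val = 2 * s + 1 then 2 * s - 2 else
      if i.val = 2 * s + 2 then 2 * s - 1 else i.val - 1, by have := i.2; split_ifs <;> omega⟩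
  have hf : Function.Injective f := by
    rintro ⟨i, hi⟩ ⟨j, hj⟩ hij
    rw [Fin.ext_iff] at hij ⊢
    simp only [f] at hij ⊢
    split_ifs at hij <;> omega
  exact ⟨Equiv.ofBijective f (Finite.injective_iff_bijective.mp hf), fun _ => rfl⟩

set_option maxHeartbeats 1600000 in
/-- For `s ≥ 3` the group of permutations preserving pairs and halves meets a conjugate of itself
trivially. -/
theorem exists_conj_preservesPairsAndHalves {s : ℕ} (hs : 3 ≤ s) :
    ∃ x : Equiv.Perm (Fin (2 * s * 2)), ∀ g, PreservesPairsAndHalves s g →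
      PreservesPairsAndHalves s (x⁻¹ * g * x) → g = 1 := by
  obtain ⟨y, hy⟩ := exists_shiftedSwap hs
  refine ⟨y⁻¹, fun g hg hg' => ?_⟩
  have hpair (u v) (h : (y u).val / 2 = (y v).val / 2) :
      (y (g u)).val / 2 = (y (g v)).val / 2 := by
    simpa using hg'.1 _ _ h
  have hhalf (u v) : ((y (g u)).val < 2 * s ↔ (y (g v)).val < 2 * s) ↔
      ((y u).val < 2 * s ↔ (y v).val < 2 * s) := by
    simpa using hg'.2 (y u) (y v)
  let Q : Fin (2 * s * 2) → Prop := fun u =>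
    (∃ v, v ≠ u ∧ (y v).val / 2 = (y u).val / 2 ∧ ¬ (v.val < 2 * s ↔ u.val < 2 * s)) ∧
      ∃ w, w ≠ u ∧ w.val / 2 = u.val / 2 ∧ ((y w).val < 2 * s ↔ (y u).val < 2 * s)
  have hQg (u) (h : Q u) : Q (g u) := by
    obtain ⟨⟨v, hv1, hv2, hv3⟩, w, hw1, hw2, hw3⟩ := h
    exact ⟨⟨g v, g.injective.ne hv1, hpair _ _ hv2, fun h => hv3 ((hg.2 _ _).mp h)⟩,
      g w, g.injective.ne hw1, hg.1 _ _ hw2, (hhalf _ _).mpr hw3⟩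
  have hlast : 4 * s - 1 < 2 * s * 2 := by omega
  have hQ (u) (h : Q u) : u = ⟨4 * s - 1, hlast⟩ := by
    obtain ⟨⟨v, hv1, hv2, hv3⟩, w, hw1, hw2, hw3⟩ := h
    have h1 := u.2
    have h2 := v.2
    have h3 := w.2
    rw [Ne, Fin.ext_iff] at hv1 hw1
    have hu : u.val = 2 * s - 1 ∨ u.val = 2 * s ∨ u.val = 0 ∨ u.val = 4 * s - 1 := by
      simp only [hy] at hv2
      clear hw3
      split_ifs at hv2 <;> omega
    ext
    simp only [hy] at hw3
    rcases hu with hu | hu | hu | hu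
    · have : w.val = 2 * s - 2 := by omega
      simp only [hu, this] at hw3
      exfalso
      split_ifs at hw3 <;> omega
    · have : w.val = 2 * s + 1 := by omega
      simp only [hu, this] at hw3
      exfalso
      split_ifs at hw3 <;> omega
    · have : w.val = 1 := by omega
      simp only [hu, this] at hw3
      exfalso
      split_ifs at hw3 <;> omega
    · exact hu
  have hstart : g ⟨4 * s - 1, hlast⟩ = ⟨4 * s - 1, hlast⟩ := by
    refine hQ _ (hQg _ ⟨⟨⟨0, by omega⟩, ?_, ?_, ?_⟩, ⟨4 * s - 2, by omega⟩, ?_, ?_, ?_⟩)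
    · rw [Ne, Fin.ext_iff]; dsimp only; omega
    · simp only [hy]; split_ifs <;> omega
    · dsimp only; omega
    · rw [Ne, Fin.ext_iff]; dsimp only; omega
    · dsimp only; omega
    · simp only [hy]; split_ifs <;> omega
  have hall (k : ℕ) (hk : k < 4 * s) :
      g ⟨4 * s - 1 - k, by omega⟩ = ⟨4 * s - 1 - k, by omega⟩ := by
    induction k with
    | zero => exact hstart
    | succ k ih =>
      have ih := ih (by omega)
      have hne : g ⟨4 * s - 1 - (k + 1), by omega⟩ ≠ g ⟨4 * s - 1 - k, by omega⟩ := by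
        apply g.injective.ne
        rw [Ne, Fin.ext_iff]; dsimp only; omega
      rw [ih, Ne, Fin.ext_iff] at hne
      by_cases hpar : k % 2 = 0
      · have h1 := hg.1 ⟨4 * s - 1 - (k + 1), by omega⟩ ⟨4 * s - 1 - k, by omega⟩
          (by dsimp only; omega)
        rw [ih] at h1
        ext
        dsimp only at h1 hne ⊢
        omega
      · have h1 := hpair ⟨4 * s - 1 - (k + 1), by omega⟩ ⟨4 * s - 1 - k, by omega⟩
          (by simp only [hy]; split_ifs <;> omega)
        rw [ih] at h1
        have h2 := (g ⟨4 * s - 1 - (k + 1), by omega⟩).2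
        ext
        simp only [hy] at h1 hne ⊢
        generalize (g ⟨4 * s - 1 - (k + 1), _⟩).val = w at *
        split_ifs at h1 <;> omega
  ext i
  have hi := i.2
  have h1 := hall (4 * s - 1 - i.val) (by omega)
  have h2 : (⟨4 * s - 1 - (4 * s - 1 - i.val), by omega⟩ : Fin (2 * s * 2)) = i := by
    ext; dsimp only; omega
  rw [h2] at h1
  rw [h1]
  rfl

/-- The permutation of eight points exchanging the two halves. -/
def octHalfSwap : Equiv.Perm (Fin 8) :=
  ⟨![4, 5, 6, 7, 0, 1, 2, 3], ![4, 5, 6, 7, 0, 1, 2, 3], by decide, by decide⟩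

/-- The permutation of eight points exchanging the two pairs in each half. -/
def octPairSwaps : Equiv.Perm (Fin 8) :=
  ⟨![2, 3, 0, 1, 6, 7, 4, 5], ![2, 3, 0, 1, 6, 7, 4, 5], by decide, by decide⟩

/-- The permutation of eight points exchanging the two pairs in the first half. -/
def octPairSwap : Equiv.Perm (Fin 8) :=
  ⟨![2, 3, 0, 1, 4, 5, 6, 7], ![2, 3, 0, 1, 4, 5, 6, 7], by decide, by decide⟩

/-- The reversal of eight points. -/
def octReversal : Equiv.Perm (Fin 8) :=
  ⟨![7, 6, 5, 4, 3, 2, 1, 0], ![7, 6, 5, 4, 3, 2, 1, 0], by decide, by decide⟩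

/-- A product of generators of the group preserving the pairs and halves of eight points. -/
def octWord (a b : Bool) (c : Fin 4 → Bool) (d : Bool) : Equiv.Perm (Fin 8) :=
  (if a then octHalfSwap else 1) * (if b then octPairSwaps else 1) *
    ((if c 0 then Equiv.swap 0 1 else 1) * (if c 1 then Equiv.swap 2 3 else 1) *
      (if c 2 then Equiv.swap 4 5 else 1) * (if c 3 then Equiv.swap 6 7 else 1)) *
    (if d then octPairSwap else 1)

theorem exists_octWord_apply : ∀ a₀ a₂ a₄ a₆ : Fin 8, a₀.val / 2 ≠ a₂.val / 2 →
    a₄.val / 2 ≠ a₆.val / 2 → (a₀.val < 4 ↔ a₂.val < 4) → (a₄.val < 4 ↔ a₆.val < 4) →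
    ¬ (a₀.val < 4 ↔ a₄.val < 4) → ∃ a b c d, octWord a b c d 0 = a₀ ∧ octWord a b c d 2 = a₂ ∧
      octWord a b c d 4 = a₄ ∧ octWord a b c d 6 = a₆ := by
  decide +kernel

theorem octWord_preserves : ∀ a b c d, PreservesPairsAndHalves 2 (octWord a b c d) := by
  unfold PreservesPairsAndHalves
  decide +kernel

theorem PreservesPairsAndHalves.apply_eq_of_pair {s : ℕ} {f g : Equiv.Perm (Fin (2 * s * 2))}
    (hf : PreservesPairsAndHalves s f) (hg : PreservesPairsAndHalves s g) (i j : Fin (2 * s * 2))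
    (hij : i ≠ j) (h : i.val / 2 = j.val / 2) (hfg : f i = g i) : f j = g j := by
  have h1 := hf.1 i j h
  have h2 := hg.1 i j h
  have h3 : (f i).val ≠ (f j).val := fun h' => hij (f.injective (Fin.ext h'))
  have h4 : (g i).val ≠ (g j).val := fun h' => hij (g.injective (Fin.ext h'))
  rw [← hfg] at h2 h4
  ext
  omega

theorem PreservesPairsAndHalves.eq_octWord {g : Equiv.Perm (Fin 8)}
    (hg : PreservesPairsAndHalves 2 g) : ∃ a b c d, g = octWord a b c d := by
  have hne (i j k : Fin 8) (hij : i ≠ j) (hik : i ≠ k) (hjk : j ≠ k)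
      (h : i.val / 2 = j.val / 2) : (g i).val / 2 ≠ (g k).val / 2 := by
    have h1 := hg.1 i j h
    have h2 : (g i).val ≠ (g j).val := fun h' => hij (g.injective (Fin.ext h'))
    have h3 : (g i).val ≠ (g k).val := fun h' => hik (g.injective (Fin.ext h'))
    have h4 : (g j).val ≠ (g k).val := fun h' => hjk (g.injective (Fin.ext h'))
    omega
  obtain ⟨a, b, c, d, h0, h2, h4, h6⟩ := exists_octWord_apply (g 0) (g 2) (g 4) (g 6)
    (hne 0 1 2 (by decide) (by decide) (by decide) rfl)
    (hne 4 5 6 (by decide) (by decide) (by decide) rfl)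
    ((hg.2 0 2).mpr (by decide)) ((hg.2 4 6).mpr (by decide))
    (fun h => absurd ((hg.2 0 4).mp h) (by decide))
  refine ⟨a, b, c, d, ?_⟩
  have hw := octWord_preserves a b c d
  have hodd := hg.apply_eq_of_pair hw
  refine Equiv.ext (Fin.forall_fin_succ.mpr ?_)
  refine ⟨h0.symm, Fin.forall_fin_succ.mpr ⟨?_, Fin.forall_fin_succ.mpr ⟨h2.symm,
    Fin.forall_fin_succ.mpr ⟨?_, Fin.forall_fin_succ.mpr ⟨h4.symm, Fin.forall_fin_succ.mpr ⟨?_,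
    Fin.forall_fin_succ.mpr ⟨h6.symm, Fin.forall_fin_one.mpr ?_⟩⟩⟩⟩⟩⟩⟩
  · exact hodd 0 1 (by decide) rfl h0.symm
  · exact hodd 2 3 (by decide) rfl h2.symm
  · exact hodd 4 5 (by decide) rfl h4.symm
  · exact hodd 6 7 (by decide) rfl h6.symm

theorem exists_conj_oct_swap : ∃ x : Equiv.Perm (Fin 8), ∀ g, PreservesPairsAndHalves 2 g →
    PreservesPairsAndHalves 2 (x⁻¹ * g * x) → g = 1 ∨ g = Equiv.swap 0 1 := by
  let x : Equiv.Perm (Fin 8) :=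
    ⟨![0, 1, 2, 4, 3, 6, 5, 7], ![0, 1, 2, 4, 3, 6, 5, 7], by decide, by decide⟩
  have key : ∀ a b c d, PreservesPairsAndHalves 2 (x⁻¹ * octWord a b c d * x) →
      octWord a b c d = 1 ∨ octWord a b c d = Equiv.swap 0 1 := by
    unfold PreservesPairsAndHalves
    decide +kernel
  refine ⟨x, fun g hg => ?_⟩
  obtain ⟨a, b, c, d, rfl⟩ := hg.eq_octWord
  exact key a b c d

theorem exists_conj_octReversal : ∃ x : Equiv.Perm (Fin 8), x⁻¹ * octReversal * x = octReversal ∧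
    ∀ g, PreservesPairsAndHalves 2 g →
      PreservesPairsAndHalves 2 (x⁻¹ * g * x) → g = 1 ∨ g = octReversal := by
  let x : Equiv.Perm (Fin 8) :=
    ⟨![0, 2, 1, 4, 3, 6, 5, 7], ![0, 2, 1, 4, 3, 6, 5, 7], by decide, by decide⟩
  have key : ∀ a b c d, PreservesPairsAndHalves 2 (x⁻¹ * octWord a b c d * x) →
      octWord a b c d = 1 ∨ octWord a b c d = octReversal := by
    unfold PreservesPairsAndHalves
    decide +kernel
  refine ⟨x, by decide, fun g hg => ?_⟩
  obtain ⟨a, b, c, d, rfl⟩ := hg.eq_octWord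
  exact key a b c d

theorem exists_conj_octPairSwaps : ∃ x : Equiv.Perm (Fin 8),
    x⁻¹ * octPairSwaps * x = octPairSwaps ∧ ∀ a b c a' b' c',
      x⁻¹ * octWord a b c false * x = octWord a' b' c' false →
      octWord a b c false = 1 ∨ octWord a b c false = octPairSwaps := by
  let x : Equiv.Perm (Fin 8) :=
    ⟨![0, 4, 2, 6, 1, 7, 3, 5], ![0, 4, 2, 6, 1, 7, 3, 5], by decide, by decide⟩
  have key : ∀ a b c a' b' c', x⁻¹ * octWord a b c false * x = octWord a' b' c' false →
      octWord a b c false = 1 ∨ octWord a b c false = octPairSwaps := by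
    decide +kernel
  exact ⟨x, by decide, key⟩

theorem PreservesPairsAndHalves.mul {s : ℕ} {f g : Equiv.Perm (Fin (2 * s * 2))}
    (hf : PreservesPairsAndHalves s f) (hg : PreservesPairsAndHalves s g) :
    PreservesPairsAndHalves s (f * g) :=
  ⟨fun i j h => hf.1 _ _ (hg.1 i j h), fun i j => (hf.2 _ _).trans (hg.2 i j)⟩

theorem PreservesPairsAndHalves.inv {s : ℕ} {g : Equiv.Perm (Fin (2 * s * 2))}
    (hg : PreservesPairsAndHalves s g) : PreservesPairsAndHalves s g⁻¹ := by
  have hpow (k : ℕ) : PreservesPairsAndHalves s (g ^ k) := by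
    induction k with
    | zero => exact ⟨fun _ _ h => h, fun _ _ => Iff.rfl⟩
    | succ k ih => rw [pow_succ]; exact ih.mul hg
  have h : g⁻¹ = g ^ (orderOf g - 1) := by
    rw [inv_eq_iff_mul_eq_one, ← pow_succ', Nat.sub_add_cancel (orderOf_pos g), pow_orderOf_eq_one]
  rw [h]
  exact hpow _

theorem octWord_mem {K : Subgroup (Equiv.Perm (Fin 8))} (hs : octHalfSwap ∈ K)
    (hp : octPairSwaps ∈ K) (h₀ : Equiv.swap 0 1 ∈ K) (h₁ : Equiv.swap 2 3 ∈ K)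
    (h₂ : Equiv.swap 4 5 ∈ K) (h₃ : Equiv.swap 6 7 ∈ K) (a b : Bool) (c : Fin 4 → Bool) :
    octWord a b c false ∈ K := by
  have hite (p : Bool) {g : Equiv.Perm (Fin 8)} (hg : g ∈ K) : (if p then g else 1) ∈ K := by
    cases p
    · exact K.one_mem
    · exact hg
  exact K.mul_mem (K.mul_mem (K.mul_mem (hite a hs) (hite b hp)) (K.mul_mem (K.mul_mem
    (K.mul_mem (hite _ h₀) (hite _ h₁)) (hite _ h₂)) (hite _ h₃))) K.one_mem

theorem octWord_true (a b : Bool) (c : Fin 4 → Bool) :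
    octWord a b c true = octWord a b c false * octPairSwap := by
  simp [octWord]

/-- A group of permutations of eight points which properly lies in the stabiliser of the pairs and
halves links any two of its representations. -/
theorem linked_of_preservesPairsAndHalves {G : Type} [Group G] [Finite G]
    (φ : G ≃* Equiv.Perm (Fin 8)) (H : Subgroup G)
    (hH : ∀ h ∈ H, PreservesPairsAndHalves 2 (φ h))
    (hproper : ∃ w, PreservesPairsAndHalves 2 w ∧ φ.symm w ∉ H)
    {A B : Type} [AddCommGroup A] [Module ℂ A] [FiniteDimensional ℂ A] [Nontrivial A]
    [AddCommGroup B] [Module ℂ B] [FiniteDimensional ℂ B] [Nontrivial B]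
    (α : Representation ℂ H A) (β : Representation ℂ H B) :
    Linked H α.character β.character := by
  by_contra hl
  have hmul {f g : Equiv.Perm (Fin 8)} (hf : PreservesPairsAndHalves 2 f)
      (hg : PreservesPairsAndHalves 2 g) : PreservesPairsAndHalves 2 (f * g) :=
    PreservesPairsAndHalves.mul hf hg
  have hinv {g : Equiv.Perm (Fin 8)} (hg : PreservesPairsAndHalves 2 g) :
      PreservesPairsAndHalves 2 g⁻¹ := PreservesPairsAndHalves.inv hg
  let K : Subgroup (Equiv.Perm (Fin 8)) := H.comap φ.symm.toMonoidHom
  have hK {g} (hg : g ∈ K) : PreservesPairsAndHalves 2 g := by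
    simpa using hH (φ.symm g) hg
  have key (x z : Equiv.Perm (Fin 8)) (hz : z * z = 1)
      (hx : ∀ g ∈ K, x⁻¹ * g * x ∈ K → g = 1 ∨ g = z) :
      ∃ (h₁ : z ∈ K) (h₂ : x⁻¹ * z * x ∈ K) (ε : ℂ), ε * ε = 1 ∧
        α ⟨φ.symm z, h₁⟩ = ε • 1 ∧ β ⟨φ.symm (x⁻¹ * z * x), h₂⟩ = (-ε) • 1 := by
    obtain h | ⟨h₁, h₂, ε, hε, h₃, h₄⟩ := linked_or_scalar H α β (φ.symm x) (φ.symm z)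
      (by rw [← map_mul, hz, map_one]) (fun g hg hg' => by
        have h1 : φ g ∈ K := by simpa [K] using hg
        have h2 : x⁻¹ * φ g * x ∈ K := by simpa [K] using hg'
        refine (hx _ h1 h2).imp (fun h => ?_) (fun h => ?_)
        · simpa using h
        · rw [← h, φ.symm_apply_apply])
    · exact absurd h hl
    · refine ⟨h₁, by simpa [K] using h₂, ε, hε, h₃, ?_⟩
      rw [← h₄]
      congr 2
      simp
  have huA {ε ε' : ℂ} (h : ε • (1 : A →ₗ[ℂ] A) = ε' • 1) : ε = ε' :=
    smul_left_injective ℂ one_ne_zero h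
  have huB {ε ε' : ℂ} (h : ε • (1 : B →ₗ[ℂ] B) = ε' • 1) : ε = ε' :=
    smul_left_injective ℂ one_ne_zero h
  have hconj {x z p q g : Equiv.Perm (Fin 8)} (hp : PreservesPairsAndHalves 2 p)
      (hq : PreservesPairsAndHalves 2 q)
      (hx : ∀ g, PreservesPairsAndHalves 2 g → PreservesPairsAndHalves 2 (x⁻¹ * g * x) →
        g = 1 ∨ g = z) (hg : g ∈ K) (hg' : (p * x * q)⁻¹ * g * (p * x * q) ∈ K) :
      g = 1 ∨ g = p * z * p⁻¹ := by
    have h1 : x⁻¹ * (p⁻¹ * g * p) * x = q * ((p * x * q)⁻¹ * g * (p * x * q)) * q⁻¹ := by group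
    refine (hx (p⁻¹ * g * p) (hmul (hmul (hinv hp) (hK hg)) hp) ?_).imp
      (fun h => ?_) (fun h => ?_)
    · rw [h1]
      exact hmul (hmul hq (hK hg')) (hinv hq)
    · rw [show g = p * (p⁻¹ * g * p) * p⁻¹ by group, h]
      group
    · rw [← h]
      group
  have hone : PreservesPairsAndHalves 2 (1 : Equiv.Perm (Fin 8)) :=
    ⟨fun _ _ h => h, fun _ _ => Iff.rfl⟩
  obtain ⟨x₁, hx₁⟩ := exists_conj_oct_swap
  have hswap {p u : Equiv.Perm (Fin 8)} (hp : PreservesPairsAndHalves 2 p)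
      (hu : p * Equiv.swap 0 1 * p⁻¹ = u) : u ∈ K := by
    obtain ⟨h, -⟩ := key (p * x₁ * 1) (p * Equiv.swap 0 1 * p⁻¹) (by simp [mul_assoc])
      (fun g hg hg' => hconj hp hone hx₁ hg hg')
    exact hu ▸ h
  obtain ⟨x₂, hxz, hx₂⟩ := exists_conj_octReversal
  have hrev2 : octReversal * octReversal = 1 := by decide
  have hrev {p q : Equiv.Perm (Fin 8)} (hp : PreservesPairsAndHalves 2 p)
      (hq : PreservesPairsAndHalves 2 q) :
      ∃ (h₁ : p * octReversal * p⁻¹ ∈ K) (h₂ : q * octReversal * q⁻¹ ∈ K) (ε : ℂ), ε * ε = 1 ∧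
        α ⟨φ.symm (p * octReversal * p⁻¹), h₁⟩ = ε • 1 ∧
        β ⟨φ.symm (q * octReversal * q⁻¹), h₂⟩ = (-ε) • 1 := by
    have h := key (p * x₂ * q⁻¹) (p * octReversal * p⁻¹)
      (by rw [show p * octReversal * p⁻¹ * (p * octReversal * p⁻¹) =
        p * (octReversal * octReversal) * p⁻¹ by group, hrev2]; group)
      (fun g hg hg' => hconj hp (hinv hq) hx₂ hg hg')
    have h' : (p * x₂ * q⁻¹)⁻¹ * (p * octReversal * p⁻¹) * (p * x₂ * q⁻¹) =
        q * octReversal * q⁻¹ := by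
      rw [← hxz]
      nth_rewrite 1 [hxz]
      group
    simpa only [h'] using h
  have hw := octWord_preserves
  have hword : octWord false false ![false, false, true, true] true * octReversal *
      (octWord false false ![false, false, true, true] true)⁻¹ = octHalfSwap := by decide
  have hword' : octWord false false ![false, false, true, true] false * octReversal *
      (octWord false false ![false, false, true, true] false)⁻¹ =
        octHalfSwap * octPairSwaps := by decide
  obtain ⟨hs, _, ε, hε, hα, hβ⟩ := hrev (hw false false ![false, false, true, true] true)
    (hw false false ![false, false, true, true] true)
  obtain ⟨hsp, _, ε₂, -, hα₂, hβ₂⟩ := hrev (hw false false ![false, false, true, true] false)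
    (hw false false ![false, false, true, true] true)
  obtain ⟨_, _, ε₃, -, hα₃, hβ₃⟩ := hrev (hw false false ![false, false, true, true] true)
    (hw false false ![false, false, true, true] false)
  simp only [hword, hword'] at hs hsp hα hβ hα₂ hβ₂ hα₃ hβ₃
  obtain rfl : ε₂ = ε := neg_injective (huB (hβ₂.symm.trans hβ))
  obtain rfl : ε₃ = ε₂ := huA (hα₃.symm.trans hα)
  have hss : octHalfSwap * (octHalfSwap * octPairSwaps) = octPairSwaps := by decide
  have hp : octPairSwaps ∈ K := hss ▸ K.mul_mem hs hsp
  have hprod : (⟨φ.symm octPairSwaps, hp⟩ : H) =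
      ⟨φ.symm octHalfSwap, hs⟩ * ⟨φ.symm (octHalfSwap * octPairSwaps), hsp⟩ := by
    ext
    rw [Subgroup.coe_mul, ← map_mul, hss]
  have hαp : α ⟨φ.symm octPairSwaps, hp⟩ = (1 : ℂ) • 1 := by
    rw [hprod, map_mul, hα, hα₂, smul_mul_smul_comm, hε, one_mul]
  have hβp : β ⟨φ.symm octPairSwaps, hp⟩ = (1 : ℂ) • 1 := by
    rw [hprod, map_mul, hβ, hβ₃, smul_mul_smul_comm, neg_mul_neg, hε, one_mul]
  have hmem := octWord_mem hs hp (hswap (hw false false (fun _ => false) false) (by decide))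
    (hswap (hw false false (fun _ => false) true) (by decide))
    (hswap (hw true false (fun _ => false) false) (by decide))
    (hswap (hw true true (fun _ => false) false) (by decide))
  have heven {a b c d} (h : octWord a b c d ∈ K) : d = false := by
    by_contra hd
    rw [Bool.not_eq_false] at hd
    rw [hd, octWord_true, K.mul_mem_cancel_left (hmem a b c)] at h
    obtain ⟨w, hwW, hwH⟩ := hproper
    obtain ⟨a', b', c', d', rfl⟩ := hwW.eq_octWord
    cases d'
    · exact hwH (hmem a' b' c')
    · rw [octWord_true] at hwH
      exact hwH (K.mul_mem (hmem a' b' c') h)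
  obtain ⟨x₃, hxp, hx₃⟩ := exists_conj_octPairSwaps
  obtain ⟨_, _, ε', -, hα', hβ'⟩ := key x₃ octPairSwaps (by decide) (fun g hg hg' => by
    obtain ⟨a, b, c, d, rfl⟩ := (hK hg).eq_octWord
    obtain ⟨a', b', c', d', h'⟩ := (hK hg').eq_octWord
    obtain rfl := heven hg
    obtain rfl := heven (h' ▸ hg')
    exact hx₃ a b c a' b' c' h')
  simp only [hxp] at hβ'
  have h1 := huA (hα'.symm.trans hαp)
  have h2 := huB (hβ'.symm.trans hβp)
  rw [h1] at h2
  norm_num at h2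

/-- Let `n ≥ 5`, `G = Sₙ`, and let `H` be a nontrivial nilpotent
subgroup of `G`, which is not a Sylow 2-subgroup in case `n = 8`. Then any two
irreducible complex characters of `H` are linked over `G`, i.e. `K(G,H)` is complete
(so `d_G(H) = 3`). -/
theorem nilpotent_symmetric_depth_three (n : ℕ) (hn : 5 ≤ n)
    (H : Subgroup (Equiv.Perm (Fin n))) (hne : H ≠ ⊥) (hnilp : Group.IsNilpotent ↥H)
    (hsyl : n = 8 → ∀ P : Sylow 2 (Equiv.Perm (Fin n)), H ≠ ↑P) :
    ∀ α β : ↥H → ℂ, IsIrrChar ↥H α → IsIrrChar ↥H β → Linked H α β := by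
  intro _ _ hα hβ
  obtain ⟨A, _, _, _, _, α, rfl⟩ := hα.exists_representation
  obtain ⟨B, _, _, _, _, β, rfl⟩ := hβ.exists_representation
  have hlink (h : ∃ x, ∀ g ∈ H, x⁻¹ * g * x ∈ H → g = 1) :
      Linked H α.character β.character := by
    obtain ⟨x, hx⟩ := h
    exact linked_of_trivial_intersection H α β x hx
  by_cases htr : ∀ i j, ∃ h ∈ H, h i = j
  swap
  · exact hlink (exists_conj_inf_trivial_of_intransitive H hne htr)
  by_cases hodd : ∃ p : ℕ, p.Prime ∧ p ≠ 2 ∧ p ∣ Nat.card H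
  · obtain ⟨p, hp, hp2, hpd⟩ := hodd
    exact hlink (exists_conj_inf_trivial_of_odd_prime hn H htr p hp hp2 hpd)
  have hpow : Nat.card H = 2 ^ (Nat.card H).primeFactorsList.length :=
    Nat.eq_prime_pow_of_unique_prime_dvd Nat.card_pos.ne' fun {p} hp hpd => by
      by_contra hp2
      exact hodd ⟨p, hp, hp2, hpd⟩
  have h2 : IsPGroup 2 H := IsPGroup.of_card hpow
  have hndvd : n ∣ Nat.card H := by
    have : MulAction.IsPretransitive H (Fin n) := ⟨fun i j => by
      obtain ⟨h, hh, hij⟩ := htr i j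
      exact ⟨⟨h, hh⟩, hij⟩⟩
    have h := (MulAction.stabilizer H (⟨0, by omega⟩ : Fin n)).index_dvd_card
    rwa [MulAction.index_stabilizer_of_transitive, Nat.card_fin] at h
  rw [hpow, Nat.dvd_prime_pow Nat.prime_two] at hndvd
  obtain ⟨m, -, hm⟩ := hndvd
  have hm3 : 3 ≤ m := by
    by_contra! h
    have := Nat.pow_le_pow_right (n := 2) two_pos (show m ≤ 2 by omega)
    omega
  obtain ⟨k, rfl⟩ := Nat.exists_eq_add_of_le hm3
  have hk : 1 ≤ 2 ^ k := Nat.one_le_two_pow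
  rw [pow_add] at hm
  obtain hk | hk := hk.eq_or_lt
  · obtain rfl : n = 8 := by omega
    obtain ⟨P, hP⟩ := h2.exists_le_sylow
    obtain ⟨e, he⟩ := exists_labelling_preservesPairsAndHalves P.1 P.2
      (fun i j => (htr i j).imp fun h hh => ⟨hP hh.1, hh.2⟩) 2 two_pos (by simp)
    obtain ⟨w, hwP, hwH⟩ := SetLike.exists_of_lt (lt_of_le_of_ne hP (hsyl rfl P))
    refine linked_of_preservesPairsAndHalves e.symm.permCongrHom H (fun h hh => he h (hP hh))
      ⟨e.symm.permCongr w, he w hwP, ?_⟩ α β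
    convert hwH
    exact e.symm.permCongrHom.symm_apply_apply w
  · have hs : 3 ≤ 2 ^ k * 2 := by omega
    obtain ⟨e, he⟩ := exists_labelling_preservesPairsAndHalves H h2 htr (2 ^ k * 2) (by omega)
      (by rw [Nat.card_fin]; omega)
    exact hlink (exists_conj_inf_trivial_of_labelling H e _ he
      (exists_conj_preservesPairsAndHalves hs))
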